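/- arXiv:math/0210184 — 4 statements merged into one kernel-verified Lean document; each statement's English description precedes it below -/
import Mathlib

section
/- Let p be a prime, K a finite extension of ℚ_p, K̄ an algebraic closure of K, and v_p the unique valuation on K̄ extending the p-adic valuation, normalized by v_p(p) = 1. Let H be a subgroup of Gal(K̄/K) and let L = K̄^H be its fixed field. If x ∈ K̄ and A ∈ ℝ satisfy v_p(σ(x) − x) ≥ A for all σ ∈ H, then there exists y ∈ L such that v_p(x − y) ≥ A − p/(p−1)². -/
open Polynomial MulAction

/-- If every `z` in `s` has absolute value at most `B`, the `i`-th coefficient of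
`∏ z ∈ s, (X - z)` has absolute value at most `B ^ (s.card - i)`. -/
theorem IsNonarchimedean.pow_mul_coeff_prod_X_sub_C_le {F ι : Type*} [Field F]
    {w : AbsoluteValue F ℝ} (hw : IsNonarchimedean w) {B : ℝ} (hB : 0 ≤ B) (s : Finset ι)
    (f : ι → F) (hf : ∀ z ∈ s, w (f z) ≤ B) (i : ℕ) :
    B ^ i * w ((∏ z ∈ s, (X - C (f z))).coeff i) ≤ B ^ s.card := by
  classical
  induction s using Finset.induction_on generalizing i with
  | empty =>
    rcases i with _ | i
    · simp
    · simp [coeff_one]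
  | insert a s ha ih =>
    have ih := ih fun z hz => hf z (Finset.mem_insert_of_mem hz)
    have hfa := hf a (Finset.mem_insert_self a s)
    rw [Finset.prod_insert ha, Finset.card_insert_of_notMem ha, pow_succ']
    set P := ∏ z ∈ s, (X - C (f z))
    have key (j : ℕ) : B ^ j * w (f a * P.coeff j) ≤ B * B ^ s.card := by
      rw [map_mul, mul_left_comm]
      exact mul_le_mul hfa (ih j) (by positivity) hB
    rcases i with _ | i
    · simpa [sub_mul, mul_coeff_zero] using key 0
    · rw [sub_mul, coeff_sub, coeff_X_mul, coeff_C_mul, sub_eq_add_neg]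
      refine (mul_le_mul_of_nonneg_left (hw _ _) (by positivity)).trans ?_
      rw [mul_max_of_nonneg _ _ (by positivity), map_neg_eq_map]
      refine max_le ?_ (key _)
      rw [pow_succ', mul_assoc]
      exact mul_le_mul_of_nonneg_left (ih i) hB

/-- Among `n > 0` nonnegative reals there is one whose `n`-th power is at most their product. -/
theorem Multiset.exists_mem_pow_card_le_prod (s : Multiset ℝ) (hs : s ≠ 0)
    (h0 : ∀ a ∈ s, 0 ≤ a) : ∃ a ∈ s, a ^ s.card ≤ s.prod := by
  obtain ⟨a, ha, hmin⟩ := s.toFinset.exists_min_image id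
    (by simpa [Finset.nonempty_iff_ne_empty] using hs)
  rw [Multiset.mem_toFinset] at ha
  refine ⟨a, ha, ?_⟩
  have := Multiset.prod_map_le_prod_map₀ (s := s) (fun _ => a) id (fun _ _ => h0 a ha)
    fun i hi => hmin i (Multiset.mem_toFinset.2 hi)
  simpa using this

/-- If the roots of a split monic polynomial of degree `n` all lie within `B` of `x`, its `q`-th
divided derivative has a root close to `x`, up to the absolute value of `n.choose q`. -/
theorem IsNonarchimedean.exists_root_hasseDeriv_prod_X_sub_C {F : Type*} [Field F] [CharZero F]
    [IsAlgClosed F] {w : AbsoluteValue F ℝ} (hw : IsNonarchimedean w) {B : ℝ} (hB : 0 < B)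
    (s : Finset F) (x : F) (hs : ∀ z ∈ s, w (z - x) ≤ B) {q : ℕ} (hq : q < s.card) :
    ∃ α, (hasseDeriv q (∏ z ∈ s, (X - C z))).IsRoot α ∧
      w (s.card.choose q) * w (x - α) ^ (s.card - q) ≤ B ^ (s.card - q) := by
  set P : F[X] := ∏ z ∈ s, (X - C z) with hP
  set Q := hasseDeriv q P with hQ
  have hPm : P.Monic := monic_prod_of_monic _ _ fun z _ => monic_X_sub_C z
  have hPd : P.natDegree = s.card := by simp [hP]
  have hQd : Q.natDegree = s.card - q := by rw [hQ, natDegree_hasseDeriv, hPd]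
  have hQl : Q.leadingCoeff = s.card.choose q := by
    have h1 : P.coeff s.card = 1 := by rw [← hPd]; exact hPm
    rw [leadingCoeff, hQd, hQ, hasseDeriv_coeff, Nat.sub_add_cancel hq.le, h1, mul_one]
  have hsp : Q.Splits := IsAlgClosed.splits Q
  have hev : Q.eval x = (∏ z ∈ s, (X - C (z - x))).coeff q := by
    rw [← taylor_coeff, hP, taylor_apply, prod_comp]
    congr 1
    refine Finset.prod_congr rfl fun z _ => ?_
    simp only [sub_comp, X_comp, C_comp, C_sub]
    ring
  have hbd : w (Q.eval x) ≤ B ^ (s.card - q) := by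
    have := hw.pow_mul_coeff_prod_X_sub_C_le hB.le s (fun z => z - x) hs q
    rw [← hev, ← Nat.add_sub_cancel' hq.le, pow_add] at this
    exact le_of_mul_le_mul_left this (by positivity)
  have hcard : Q.roots.card = s.card - q := by rw [← hsp.natDegree_eq_card_roots, hQd]
  obtain ⟨a, ha, hle⟩ := Multiset.exists_mem_pow_card_le_prod
    (Q.roots.map fun α => w (x - α))
    (by rw [← Multiset.card_pos, Multiset.card_map, hcard]; omega)
    (by simp only [Multiset.mem_map]; rintro _ ⟨α, -, rfl⟩; exact w.nonneg _)
  obtain ⟨α, hα, rfl⟩ := Multiset.mem_map.1 ha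
  refine ⟨α, isRoot_of_mem_roots hα, ?_⟩
  rw [Multiset.card_map, hcard] at hle
  refine (mul_le_mul_of_nonneg_left hle (w.nonneg _)).trans ?_
  have hprod : w (Q.roots.map fun α => x - α).prod = (Q.roots.map fun α => w (x - α)).prod := by
    rw [map_multiset_prod, Multiset.map_map]; rfl
  rwa [← hQl, ← hprod, ← map_mul, ← hsp.eval_eq_prod_roots]

/-- The roots of a divided derivative of the polynomial whose roots form a finite orbit are stable
under the group. -/
theorem isRoot_hasseDeriv_orbit_smul {F G : Type*} [Field F] [Group G] [MulSemiringAction G F]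
    {x : F} {s : Finset F} (hs : (s : Set F) = orbit G x) (q : ℕ) (g : G) {α : F}
    (h : (hasseDeriv q (∏ z ∈ s, (X - C z))).IsRoot α) :
    (hasseDeriv q (∏ z ∈ s, (X - C z))).IsRoot (g • α) := by
  set P : F[X] := ∏ z ∈ s, (X - C z) with hP
  set φ : F →+* F := MulSemiringAction.toRingHom G F g
  have hmem (z : F) (g : G) : g • z ∈ s ↔ z ∈ s := by
    rw [← Finset.mem_coe, ← Finset.mem_coe, hs, ← orbit_eq_iff, orbit_smul, orbit_eq_iff]
  have hPφ : P.map φ = P := by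
    rw [hP, Polynomial.map_prod]
    refine Finset.prod_bij (fun z _ => g • z) (fun z hz => (hmem z g).2 hz)
      (fun a _ b _ hab => smul_left_cancel g hab)
      (fun b hb => ⟨g⁻¹ • b, (hmem b g⁻¹).2 hb, smul_inv_smul g b⟩) fun z _ => ?_
    simp [φ]
  have hQφ : (hasseDeriv q P).map φ = hasseDeriv q P := by
    ext i
    rw [coeff_map, hasseDeriv_coeff, map_mul, map_natCast, ← coeff_map, hPφ]
  have := h.map (f := φ)
  rwa [hQφ] at this

/-- The constant `∑ i < l, 1 / (p ^ i * (p - 1))` in Ax's approximation, in closed form. -/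
noncomputable def axExponent (p l : ℕ) : ℝ := (p : ℝ) / ((p : ℝ) - 1) ^ 2 * (1 - ((p : ℝ) ^ l)⁻¹)

theorem axExponent_mono {p : ℕ} [hp : Fact p.Prime] : Monotone (axExponent p) := by
  intro a b hab
  have h1 : (1 : ℝ) ≤ p := by exact_mod_cast hp.out.one_lt.le
  unfold axExponent
  gcongr

theorem axExponent_nonneg {p : ℕ} [hp : Fact p.Prime] (l : ℕ) : 0 ≤ axExponent p l := by
  simpa [axExponent] using axExponent_mono (p := p) l.zero_le

theorem axExponent_le (p l : ℕ) : axExponent p l ≤ (p : ℝ) / ((p : ℝ) - 1) ^ 2 :=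
  mul_le_of_le_one_right (by positivity) (by simp)

theorem axExponent_succ {p : ℕ} [hp : Fact p.Prime] (l : ℕ) :
    axExponent p (l + 1) = 1 / ((p ^ (l + 1) - p ^ l : ℕ) : ℝ) + axExponent p l := by
  have h1 : (1 : ℝ) < p := by exact_mod_cast hp.out.one_lt
  have h2 : (p : ℝ) - 1 ≠ 0 := by linarith
  have h3 : (p : ℝ) ≠ 0 := by positivity
  rw [Nat.cast_sub (Nat.pow_le_pow_right hp.out.pos (Nat.le_succ l))]
  have h4 : (p : ℝ) ^ (l + 1) - p ^ l = p ^ l * (p - 1) := by ring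
  push_cast
  rw [h4]
  unfold axExponent
  field_simp
  ring

theorem Padic.norm_choose_mul_prime_pow {p : ℕ} [hp : Fact p.Prime] (k : ℕ) {d : ℕ}
    (hd : ¬ p ∣ d) : ‖(((p ^ k * d).choose (p ^ k) : ℕ) : ℚ_[p])‖ = 1 := by
  have h : (p ^ k * d).choose (p ^ k) ≡ d [MOD p] := by
    induction k with
    | zero => simpa using Nat.ModEq.refl d
    | succ k ih =>
      refine (Choose.choose_modEq_choose_mod_mul_choose_div_nat (p := p)).trans ?_
      rw [pow_succ', mul_assoc, Nat.mul_mod_right, Nat.mul_mod_right,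
        Nat.mul_div_cancel_left _ hp.out.pos, Nat.mul_div_cancel_left _ hp.out.pos]
      simpa using ih
  rw [Padic.norm_natCast_eq_one_iff, Nat.coprime_comm, Nat.coprime_comm,
    Nat.Prime.coprime_iff_not_dvd hp.out, h.dvd_iff dvd_rfl]
  exact hd

theorem Padic.norm_choose_prime_pow_succ {p : ℕ} [hp : Fact p.Prime] (k : ℕ) :
    ‖(((p ^ (k + 1)).choose (p ^ k) : ℕ) : ℚ_[p])‖ = (p : ℝ)⁻¹ := by
  have hle : p ^ k ≤ p ^ (k + 1) := Nat.pow_le_pow_right hp.out.pos k.le_succ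
  have hne : (p ^ (k + 1)).choose (p ^ k) ≠ 0 := (Nat.choose_pos hle).ne'
  have h := Nat.factorization_choose_prime_pow hp.out hle (pow_pos hp.out.pos k).ne'
  rw [Nat.factorization_pow, Finsupp.smul_apply, hp.out.factorization_self] at h
  rw [Padic.norm_eq_zpow_neg_valuation (by exact_mod_cast hne), Padic.valuation_natCast,
    ← Nat.factorization_def _ hp.out, h]
  simp

/-- Ax's approximation theorem for a group of isometries with finite orbits. -/
theorem exists_fixed_approximation {p : ℕ} [hp : Fact p.Prime] {F G : Type*} [Field F]
    [CharZero F] [IsAlgClosed F] [Group G] [MulSemiringAction G F] {w : AbsoluteValue F ℝ}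
    (hw : IsNonarchimedean w) (hwp : ∀ n : ℕ, w n = ‖(n : ℚ_[p])‖)
    (hwG : ∀ (g : G) (x : F), w (g • x) = w x) (x : F) (hfin : (orbit G x).Finite) {B : ℝ}
    (hB : 0 < B) (hx : ∀ g : G, w (g • x - x) ≤ B) :
    ∃ y, (∀ g : G, g • y = y) ∧
      w (x - y) ≤ B * (p : ℝ) ^ axExponent p (Nat.log p (orbit G x).ncard) := by
  induction hn : (orbit G x).ncard using Nat.strong_induction_on generalizing x B with
  | _ n ih =>
  have hp1 : (1 : ℝ) ≤ p := by exact_mod_cast hp.out.one_lt.le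
  set s := hfin.toFinset with hs
  have hs' : (s : Set F) = orbit G x := hfin.coe_toFinset
  have hsn : s.card = n := by rw [← hn, Set.ncard_eq_toFinset_card _ hfin]
  have hsB : ∀ z ∈ s, w (z - x) ≤ B := by
    intro z hz
    obtain ⟨g, rfl⟩ := hfin.mem_toFinset.1 hz
    exact hx g
  -- one approximation step, through a root of a divided derivative of the orbit polynomial
  have step (q : ℕ) (hq0 : 0 < q) (hq : q < n) (e : ℝ) (he : 0 ≤ e)
      (hc : ((p : ℝ) ^ e) ^ (n - q) * ‖((n.choose q : ℕ) : ℚ_[p])‖ = 1)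
      (hlog : ∀ m < n, e + axExponent p (Nat.log p m) ≤ axExponent p (Nat.log p n)) :
      ∃ y, (∀ g : G, g • y = y) ∧ w (x - y) ≤ B * (p : ℝ) ^ axExponent p (Nat.log p n) := by
    obtain ⟨α, hα, hle⟩ := hw.exists_root_hasseDeriv_prod_X_sub_C hB s x hsB (hsn ▸ hq)
    rw [hsn, hwp] at hle
    have hpe : 1 ≤ (p : ℝ) ^ e := Real.one_le_rpow hp1 he
    set B' := B * (p : ℝ) ^ e with hB'
    have hBB' : B ≤ B' := le_mul_of_one_le_right hB.le hpe
    have hxα : w (x - α) ≤ B' := by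
      refine le_of_pow_le_pow_left₀ (n := n - q) (by omega) (by positivity) ?_
      calc w (x - α) ^ (n - q)
          = ((p : ℝ) ^ e) ^ (n - q) * (‖((n.choose q : ℕ) : ℚ_[p])‖ * w (x - α) ^ (n - q)) := by
            rw [← mul_assoc, hc, one_mul]
        _ ≤ ((p : ℝ) ^ e) ^ (n - q) * B ^ (n - q) := by gcongr
        _ = B' ^ (n - q) := by rw [hB', mul_pow, mul_comm]
    have hQd : (hasseDeriv q (∏ z ∈ s, (X - C z))).natDegree = n - q := by
      rw [natDegree_hasseDeriv, natDegree_prod_of_monic _ _ fun z _ => monic_X_sub_C z]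
      simp [hsn]
    have hQ0 : hasseDeriv q (∏ z ∈ s, (X - C z)) ≠ 0 := by
      intro h0
      rw [h0, natDegree_zero] at hQd
      omega
    classical
    have hsub : orbit G α ⊆ (hasseDeriv q (∏ z ∈ s, (X - C z))).roots.toFinset := by
      rintro _ ⟨g, rfl⟩
      rw [Finset.mem_coe, Multiset.mem_toFinset, mem_roots hQ0]
      exact isRoot_hasseDeriv_orbit_smul hs' q g hα
    have hαfin : (orbit G α).Finite := (Finset.finite_toSet _).subset hsub
    have hαn : (orbit G α).ncard < n := by
      have h1 := Set.ncard_le_ncard hsub (Finset.finite_toSet _)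
      rw [Set.ncard_coe_finset] at h1
      have h2 := (Multiset.toFinset_card_le _).trans
        (card_roots' (hasseDeriv q (∏ z ∈ s, (X - C z))))
      omega
    have hαB (g : G) : w (g • α - α) ≤ B' := by
      have : g • α - α = (g • (α - x) + (g • x - x)) + (x - α) := by rw [smul_sub]; ring
      rw [this]
      refine (hw _ _).trans (max_le ((hw _ _).trans (max_le ?_ ((hx g).trans hBB'))) hxα)
      rwa [hwG, w.map_sub]
    obtain ⟨y, hy, hyα⟩ := ih _ hαn α hαfin (by positivity) hαB rfl
    refine ⟨y, hy, ?_⟩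
    have hfinal : B' * (p : ℝ) ^ axExponent p (Nat.log p (orbit G α).ncard) ≤
        B * (p : ℝ) ^ axExponent p (Nat.log p n) := by
      rw [hB', mul_assoc, ← Real.rpow_add (by positivity)]
      gcongr
      exact hlog _ hαn
    rw [← sub_add_sub_cancel x α y]
    refine (hw _ _).trans (max_le (hxα.trans (le_trans ?_ hfinal)) (hyα.trans hfinal))
    exact le_mul_of_one_le_right (by positivity) (Real.one_le_rpow hp1 (axExponent_nonneg _))
  have hn0 : n ≠ 0 := by
    rw [← hn]
    exact (Set.ncard_pos hfin).2 ⟨x, mem_orbit_self x⟩ |>.ne'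
  obtain ⟨k, d, hd, hnd⟩ := Nat.exists_eq_pow_mul_and_not_dvd hn0 p hp.out.ne_one
  have hpk : 0 < p ^ k := pow_pos hp.out.pos k
  have hd0 : d ≠ 0 := by rintro rfl; simp at hd
  by_cases hd1 : d = 1
  · rcases k with _ | k
    · refine ⟨x, fun g => ?_, by rw [sub_self, map_zero]; positivity⟩
      rw [pow_zero, one_mul, hd1, ← hn, Set.ncard_eq_one] at hnd
      obtain ⟨a, ha⟩ := hnd
      have h1 : g • x ∈ orbit G x := mem_orbit x g
      have h2 := mem_orbit_self (M := G) x
      rw [ha, Set.mem_singleton_iff] at h1 h2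
      rw [h1, ← h2]
    · rw [hd1, mul_one] at hnd
      have hlt : p ^ k < p ^ (k + 1) := Nat.pow_lt_pow_right hp.out.one_lt k.lt_succ_self
      refine step (p ^ k) (pow_pos hp.out.pos k) (hnd ▸ hlt)
        (1 / ((p ^ (k + 1) - p ^ k : ℕ) : ℝ)) (by positivity) ?_ ?_
      · have hpos : ((p ^ (k + 1) - p ^ k : ℕ) : ℝ) ≠ 0 := by
          exact_mod_cast (Nat.sub_pos_of_lt hlt).ne'
        rw [hnd, Padic.norm_choose_prime_pow_succ, ← Real.rpow_natCast, ← Real.rpow_mul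
          (by positivity), one_div_mul_cancel hpos, Real.rpow_one]
        exact mul_inv_cancel₀ (by positivity)
      · intro m hm
        rw [hnd, Nat.log_pow hp.out.one_lt, axExponent_succ]
        gcongr
        exact axExponent_mono (Nat.lt_succ_iff.1 (Nat.log_lt_of_lt_pow' k.succ_ne_zero (hnd ▸ hm)))
  · refine step (p ^ k) hpk ?_ 0 le_rfl ?_ fun m hm => ?_
    · rw [hnd]
      exact lt_mul_of_one_lt_right hpk (by omega)
    · rw [hnd, Padic.norm_choose_mul_prime_pow k hd]
      simp
    · rw [zero_add]
      exact axExponent_mono (Nat.log_mono_right hm.le)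

/-- An additive real valuation, with its value at `0` ignored, as an absolute value. -/
theorem exists_absoluteValue_eq_rpow_neg {F : Type*} [Field F] (b : ℝ) (hb : 1 < b)
    (v : F → ℝ) (hv_mul : ∀ x y : F, x ≠ 0 → y ≠ 0 → v (x * y) = v x + v y)
    (hv_add : ∀ x y : F, x ≠ 0 → y ≠ 0 → x + y ≠ 0 → min (v x) (v y) ≤ v (x + y)) :
    ∃ w : AbsoluteValue F ℝ, IsNonarchimedean w ∧ ∀ x ≠ 0, w x = b ^ (-v x) := by
  classical
  have hb0 : 0 < b := by linarith
  set f : F → ℝ := fun x => if x = 0 then 0 else b ^ (-v x) with hf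
  have f0 : f 0 = 0 := if_pos rfl
  have f1 (x : F) (hx : x ≠ 0) : f x = b ^ (-v x) := if_neg hx
  have fnn (x : F) : 0 ≤ f x := by
    simp only [hf]; split_ifs <;> positivity
  have fna : IsNonarchimedean f := by
    intro x y
    by_cases hx : x = 0
    · simp [hx]
    by_cases hy : y = 0
    · simp [hy]
    by_cases hxy : x + y = 0
    · rw [hxy, f0]; exact le_max_of_le_left (fnn x)
    rw [f1 x hx, f1 y hy, f1 _ hxy]
    rcases min_le_iff.1 (hv_add x y hx hy hxy) with h | h
    · exact le_max_of_le_left (Real.rpow_le_rpow_of_exponent_le hb.le (neg_le_neg h))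
    · exact le_max_of_le_right (Real.rpow_le_rpow_of_exponent_le hb.le (neg_le_neg h))
  refine ⟨⟨⟨f, fun x y => ?_⟩, fnn, fun x => ⟨fun h => ?_, fun h => h ▸ f0⟩, fun x y => ?_⟩,
    fna, f1⟩
  · by_cases hx : x = 0
    · simp [hx, f0]
    by_cases hy : y = 0
    · simp [hy, f0]
    rw [f1 x hx, f1 y hy, f1 _ (mul_ne_zero hx hy), hv_mul x y hx hy, neg_add,
      Real.rpow_add hb0]
  · by_contra hx
    have h' : f x = 0 := h
    rw [f1 x hx] at h'
    exact (Real.rpow_pos_of_pos hb0 _).ne' h'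
  · exact (fna x y).trans (max_le_add_of_nonneg (fnn x) (fnn y))


/-- Ax's form of the Ax–Sen–Tate theorem: let `K` be a finite extension of `ℚ_p`, `K̄` an
algebraic closure, and `v` the unique valuation of `K̄` extending the `p`-adic valuation
(normalized by `v p = 1`).  If `H` is a subgroup of `Gal(K̄/K)` with fixed field `L = K̄^H`,
and `x ∈ K̄`, `A ∈ ℝ` satisfy `v (σ x - x) ≥ A` for all `σ ∈ H` (with `v 0 = ∞`), then there
is `y ∈ L` with `v (x - y) ≥ A - p/(p-1)²`. -/
theorem ax_sen_tate (p : ℕ) [Fact p.Prime]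
    (K : Type*) [Field K] [Algebra ℚ_[p] K] [FiniteDimensional ℚ_[p] K]
    (v : AlgebraicClosure K → ℝ)
    (hv_mul : ∀ x y : AlgebraicClosure K, x ≠ 0 → y ≠ 0 → v (x * y) = v x + v y)
    (hv_add : ∀ x y : AlgebraicClosure K,
      x ≠ 0 → y ≠ 0 → x + y ≠ 0 → min (v x) (v y) ≤ v (x + y))
    (hv_ext : ∀ a : ℚ_[p], a ≠ 0 →
      v (algebraMap K (AlgebraicClosure K) (algebraMap ℚ_[p] K a)) = (a.valuation : ℝ))
    (H : Subgroup (AlgebraicClosure K ≃ₐ[K] AlgebraicClosure K))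
    (x : AlgebraicClosure K) (A : ℝ)
    (hx : ∀ σ ∈ H, σ x = x ∨ A ≤ v (σ x - x)) :
    ∃ y ∈ IntermediateField.fixedField H,
      x = y ∨ A - (p : ℝ) / ((p : ℝ) - 1) ^ 2 ≤ v (x - y) := by
  have hp : p.Prime := Fact.out
  have hp1 : (1 : ℝ) < p := by exact_mod_cast hp.one_lt
  have hp0 : (0 : ℝ) < p := by linarith
  obtain ⟨w, hw, hwv⟩ := exists_absoluteValue_eq_rpow_neg (p : ℝ) hp1 v hv_mul hv_add
  have hext (a : ℚ_[p]) : w (algebraMap ℚ_[p] (AlgebraicClosure K) a) = ‖a‖ := by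
    by_cases ha : a = 0
    · simp [ha]
    rw [hwv _ (by simpa using ha), IsScalarTower.algebraMap_apply ℚ_[p] K, hv_ext a ha,
      Padic.norm_eq_zpow_neg_valuation ha, ← Real.rpow_intCast]
    simp
  have : CharZero (AlgebraicClosure K) :=
    charZero_of_injective_algebraMap (algebraMap ℚ_[p] (AlgebraicClosure K)).injective
  have : Algebra.IsAlgebraic ℚ_[p] (AlgebraicClosure K) :=
    Algebra.IsAlgebraic.trans ℚ_[p] K (AlgebraicClosure K)
  have hiso (σ : H) (z : AlgebraicClosure K) : w (σ • z) = w z := by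
    rw [spectralNorm_unique_field_norm_ext hext, spectralNorm_unique_field_norm_ext hext,
      spectralNorm_eq_of_equiv (σ.1.restrictScalars ℚ_[p]) z]
    rfl
  have hfin : (MulAction.orbit H x).Finite := by
    refine ((minpoly K x).rootSet_finite (AlgebraicClosure K)).subset ?_
    rintro _ ⟨σ, rfl⟩
    rw [Polynomial.mem_rootSet]
    refine ⟨minpoly.ne_zero (Algebra.IsIntegral.isIntegral x), ?_⟩
    change Polynomial.aeval (σ.1 x) _ = 0
    rw [Polynomial.aeval_algHom_apply, minpoly.aeval, map_zero]
  have hxB (σ : H) : w (σ • x - x) ≤ (p : ℝ) ^ (-A) := by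
    change w (σ.1 x - x) ≤ _
    by_cases h0 : σ.1 x - x = 0
    · rw [h0, map_zero]; positivity
    rw [hwv _ h0]
    exact Real.rpow_le_rpow_of_exponent_le hp1.le
      (neg_le_neg ((hx σ.1 σ.2).resolve_left fun h => h0 (sub_eq_zero.2 h)))
  obtain ⟨y, hy, hxy⟩ := exists_fixed_approximation (p := p) hw
    (fun n => by rw [← hext n, map_natCast (algebraMap ℚ_[p] (AlgebraicClosure K))])
    hiso x hfin (by positivity) hxB
  refine ⟨y, fun σ => hy σ, ?_⟩
  by_cases h0 : x - y = 0
  · exact Or.inl (sub_eq_zero.1 h0)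
  right
  rw [hwv _ h0, ← Real.rpow_add hp0, Real.rpow_le_rpow_left_iff hp1] at hxy
  linarith [axExponent_le p (Nat.log p (MulAction.orbit H x).ncard)]
end

section
/- Fix a prime p. Let K be a finite extension of ℚ_p, K̄ an algebraic closure of K, and v_p the unique valuation on K̄ extending the p-adic valuation, normalized by v_p(p) = 1. Let ℂ_p = C be the completion of K̄; each element of G_K = Gal(K̄/K) acts isometrically on K̄ and hence extends uniquely to a continuous field automorphism of C, giving a G_K-action on C. Then for every closed subgroup H of G_K, the fixed field C^H equals the closure of K̄^H in C (i.e., C^H is the completion of K̄^H). -/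
theorem not_dvd_choose_prime_pow_mul {p : ℕ} (hp : p.Prime) (k d : ℕ) (hd : ¬ p ∣ d) :
    ¬ p ∣ (p ^ k * d).choose (p ^ k) := by
  have := Fact.mk hp
  have h : (p ^ k * d).choose (p ^ k) ≡ d [MOD p] := by
    induction k with
    | zero => simp [Nat.ModEq]
    | succ k ih =>
      refine (Choose.choose_modEq_choose_mod_mul_choose_div_nat (p := p)).trans ?_
      rw [pow_succ', mul_assoc, Nat.mul_mod_right, Nat.mul_mod_right,
        Nat.mul_div_cancel_left _ hp.pos, Nat.mul_div_cancel_left _ hp.pos]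
      simpa using ih
  rwa [h.dvd_iff dvd_rfl]

theorem exists_choose_prime_pow_succ_eq_mul {p : ℕ} (hp : p.Prime) (k : ℕ) :
    ∃ m, ¬ p ∣ m ∧ (p ^ (k + 1)).choose (p ^ k) = p * m := by
  have h := hp.emultiplicity_choose_prime_pow (n := k + 1)
    (Nat.pow_le_pow_right hp.pos k.le_succ) (pow_ne_zero k hp.ne_zero)
  rw [multiplicity_pow_self_of_prime hp.prime, Nat.add_sub_cancel_left,
    emultiplicity_eq_coe] at h
  obtain ⟨⟨m, hm⟩, h2⟩ := h
  rw [pow_one] at hm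
  refine ⟨m, fun ⟨r, hr⟩ ↦ h2 ⟨r, ?_⟩, hm⟩
  rw [hm, hr]; ring

section Ultrametric

open Polynomial

variable {L : Type*} [NormedField L] [IsUltrametricDist L]

/-- The coefficients of a product of linear factors `X + a` with `‖a‖ ≤ δ`. -/
theorem norm_coeff_prod_X_add_C_le {δ : ℝ} (hδ : 0 ≤ δ) (s : Multiset L)
    (hs : ∀ a ∈ s, ‖a‖ ≤ δ) (i j : ℕ) (hij : i + j = s.card) :
    ‖(s.map fun a ↦ X + C a).prod.coeff i‖ ≤ δ ^ j := by
  induction s using Multiset.induction_on generalizing i j with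
  | empty =>
    obtain ⟨rfl, rfl⟩ : i = 0 ∧ j = 0 := by simpa using hij
    simp
  | cons a s ih =>
    have hs' : ∀ b ∈ s, ‖b‖ ≤ δ := fun b hb ↦ hs b (Multiset.mem_cons_of_mem hb)
    have ha : ‖a‖ ≤ δ := hs a (Multiset.mem_cons_self a s)
    rw [Multiset.card_cons] at hij
    rw [Multiset.map_cons, Multiset.prod_cons, add_mul, coeff_add, coeff_C_mul]
    refine (IsUltrametricDist.norm_add_le_max _ _).trans (max_le ?_ ?_)
    · cases i with
      | zero => simpa using pow_nonneg hδ j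
      | succ i => rw [coeff_X_mul]; exact ih hs' i j (by omega)
    · cases j with
      | zero =>
        rw [coeff_eq_zero_of_natDegree_lt]
        · simp
        · rw [natDegree_multiset_prod_of_monic _ fun f hf ↦ by
            obtain ⟨b, -, rfl⟩ := Multiset.mem_map.1 hf
            exact monic_X_add_C b]
          simp; omega
      | succ j =>
        rw [norm_mul, pow_succ']
        exact mul_le_mul ha (ih hs' i j (by omega)) (norm_nonneg _) hδ

theorem norm_eval_hasseDeriv_le [IsAlgClosed L] {P : L[X]} (hP : P.Monic) {α : L} {δ : ℝ}
    (hδ : 0 ≤ δ) (hroots : ∀ r ∈ P.roots, ‖α - r‖ ≤ δ) {i j : ℕ} (hij : i + j = P.natDegree) :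
    ‖(hasseDeriv i P).eval α‖ ≤ δ ^ j := by
  have hsplit := IsAlgClosed.splits P
  have h : taylor α P = ((P.roots.map fun r ↦ α - r).map fun a ↦ X + C a).prod := by
    conv_lhs => rw [hsplit.eq_prod_roots_of_monic hP]
    rw [← taylorAlgHom_apply, map_multiset_prod, Multiset.map_map, Multiset.map_map]
    congr 1
    refine Multiset.map_congr rfl fun r _ ↦ ?_
    simp [sub_eq_add_neg, add_assoc]
  rw [← taylor_coeff, h]
  refine norm_coeff_prod_X_add_C_le hδ _ (fun a ha ↦ ?_) i j ?_
  · obtain ⟨r, hr, rfl⟩ := Multiset.mem_map.1 ha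
    exact hroots r hr
  · rw [hij, Multiset.card_map, hsplit.natDegree_eq_card_roots]

/-- If all roots of the monic polynomial `P` are at distance at most `δ` from `α`, then its
Hasse derivatives have a root close to `α`. -/
theorem exists_root_hasseDeriv_norm_sub_le [IsAlgClosed L] [CharZero L] {P : L[X]}
    (hP : P.Monic) {α : L} {δ B : ℝ} (hδ : 0 ≤ δ) (hB : 0 ≤ B)
    (hroots : ∀ r ∈ P.roots, ‖α - r‖ ≤ δ) {i j : ℕ} (hij : i + j = P.natDegree) (hj : j ≠ 0)
    (h : δ ^ j ≤ ‖(P.natDegree.choose i : L)‖ * B ^ j) :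
    ∃ β, (hasseDeriv i P).eval β = 0 ∧ ‖α - β‖ ≤ B := by
  set R := hasseDeriv i P
  have hdeg : R.natDegree = j := by rw [natDegree_hasseDeriv]; omega
  have hlead : R.leadingCoeff = (P.natDegree.choose i : L) := by
    rw [leadingCoeff, hdeg, hasseDeriv_coeff, add_comm, hij, hP.coeff_natDegree, mul_one]
  have hchoose : (P.natDegree.choose i : L) ≠ 0 :=
    Nat.cast_ne_zero.2 (Nat.choose_pos (by omega)).ne'
  have hR : R ≠ 0 := leadingCoeff_ne_zero.1 (hlead ▸ hchoose)
  have hsplit := IsAlgClosed.splits R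
  by_contra! hcon
  have key : B ^ j < ((R.roots.map fun r ↦ α - r).map norm).prod := by
    have hlt : ∀ s : Multiset L, (∀ r ∈ s, B < ‖α - r‖) → s ≠ 0 →
        B ^ s.card < ((s.map fun r ↦ α - r).map norm).prod := by
      intro s
      induction s using Multiset.induction_on with
      | empty => simp
      | cons a s ih =>
        intro hs _
        have ha := hs a (Multiset.mem_cons_self a s)
        rcases eq_or_ne s 0 with rfl | hs0
        · simpa using ha
        · have := ih (fun r hr ↦ hs r (Multiset.mem_cons_of_mem hr)) hs0
          simp only [Multiset.card_cons, Multiset.map_cons, Multiset.prod_cons, pow_succ']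
          exact mul_lt_mul'' ha this hB (pow_nonneg hB _)
    have hcard : R.roots.card = j := by rw [← hsplit.natDegree_eq_card_roots, hdeg]
    rw [← hcard]
    refine hlt _ (fun r hr ↦ hcon r ((mem_roots hR).1 hr)) fun h0 ↦ hj ?_
    rw [← hcard, h0, Multiset.card_zero]
  have hle := norm_eval_hasseDeriv_le hP hδ hroots hij
  rw [hsplit.eval_eq_prod_roots, hlead, norm_mul] at hle
  have hprod : ‖(R.roots.map fun r ↦ α - r).prod‖ = ((R.roots.map fun r ↦ α - r).map norm).prod :=
    map_multiset_prod (normHom : L →*₀ ℝ) _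
  rw [hprod] at hle
  exact absurd (hle.trans h) (not_le.2 (mul_lt_mul_of_pos_left key (norm_pos_iff.2 hchoose)))

/-- **Ax lemma**: an element `α` of an algebraic closure `L` of a valued field `F` of residue
characteristic `p` which is moved by at most `δ` by the Galois group is within `p ^ 2 * δ` of
`F`. -/
theorem exists_norm_sub_algebraMap_le [IsAlgClosed L] [CharZero L] {F : Type*} [Field F]
    [Algebra F L] [IsGalois F L] {p : ℕ} (hp : p.Prime) (hnorm_p : ‖(p : L)‖ = (p : ℝ)⁻¹)
    (hnorm : ∀ m : ℕ, ¬ p ∣ m → ‖(m : L)‖ = 1) (hinv : ∀ (σ : L ≃ₐ[F] L) x, ‖σ x‖ = ‖x‖)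
    (α : L) {δ : ℝ} (hδ : 0 ≤ δ) (hα : ∀ σ : L ≃ₐ[F] L, ‖σ α - α‖ ≤ δ) :
    ∃ a : F, ‖α - algebraMap F L a‖ ≤
      (p : ℝ) ^ (2 - 2 / 2 ^ Nat.log p (minpoly F α).natDegree : ℝ) * δ := by
  have hp1 : (1 : ℝ) ≤ p := by exact_mod_cast hp.one_le
  have hp0 : (0 : ℝ) < p := zero_lt_one.trans_le hp1
  have hone : ∀ l : ℕ, 1 ≤ (p : ℝ) ^ (2 - 2 / 2 ^ l : ℝ) := fun l ↦ by
    refine Real.one_le_rpow hp1 (sub_nonneg.2 ?_)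
    exact div_le_self zero_le_two (one_le_pow₀ one_le_two)
  have hmono : ∀ l m : ℕ, l ≤ m →
      (p : ℝ) ^ (2 - 2 / 2 ^ l : ℝ) ≤ (p : ℝ) ^ (2 - 2 / 2 ^ m : ℝ) := fun l m hlm ↦ by
    refine Real.rpow_le_rpow_of_exponent_le hp1 (sub_le_sub_left ?_ _)
    gcongr
    exact one_le_two
  induction hn : (minpoly F α).natDegree using Nat.strong_induction_on generalizing α δ with
  | _ n ih =>
  have hint : IsIntegral F α := Algebra.IsIntegral.isIntegral α
  have hn0 : 0 < n := hn ▸ minpoly.natDegree_pos hint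
  have : CharZero F :=
    (RingHom.charZero_iff (algebraMap F L).injective).2 inferInstance
  set P := (minpoly F α).map (algebraMap F L) with hPdef
  have hP : P.Monic := (minpoly.monic hint).map _
  have hPdeg : P.natDegree = n := by rw [natDegree_map, hn]
  have hroots : ∀ r ∈ P.roots, ‖α - r‖ ≤ δ := by
    intro r hr
    have hr0 : aeval r (minpoly F α) = 0 := by
      rw [← eval_map_algebraMap]
      exact (mem_roots hP.ne_zero).1 hr
    obtain ⟨σ, hσ⟩ :=
      isConjRoot_iff_exists_algEquiv.1 (isConjRoot_of_aeval_eq_zero hint hr0).symm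
    rw [← hσ, norm_sub_rev]
    exact hα σ
  have step : ∀ i j : ℕ, i + j = n → j ≠ 0 → ∀ B, δ ≤ B →
      δ ^ j ≤ ‖(n.choose i : L)‖ * B ^ j →
      ∃ β, ‖α - β‖ ≤ B ∧ (minpoly F β).natDegree ≤ j ∧ ∀ σ : L ≃ₐ[F] L, ‖σ β - β‖ ≤ B := by
    intro i j hij hj B hB h
    obtain ⟨β, hβ, hαβ⟩ := exists_root_hasseDeriv_norm_sub_le hP hδ (hδ.trans hB) hroots
      (hij.trans hPdeg.symm) hj (by rwa [hPdeg])
    refine ⟨β, hαβ, ?_, fun σ ↦ ?_⟩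
    · have hmap : hasseDeriv i P = (hasseDeriv i (minpoly F α)).map (algebraMap F L) := by
        ext k
        simp [hasseDeriv_coeff, hPdef]
      have hdeg : (hasseDeriv i (minpoly F α)).natDegree = j := by
        rw [natDegree_hasseDeriv, hn]; omega
      rw [← hdeg]
      refine natDegree_le_of_dvd (minpoly.dvd F β ?_) fun h0 ↦ hj ?_
      · rw [← eval_map_algebraMap, ← hmap, hβ]
      · rw [← hdeg, h0, natDegree_zero]
    · have heq : σ β - β = (α - β) - σ (α - β) + (σ α - α) := by rw [map_sub]; ring
      rw [heq]
      refine (IsUltrametricDist.norm_add_le_max _ _).trans (max_le ?_ ((hα σ).trans hB))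
      rw [sub_eq_add_neg]
      refine (IsUltrametricDist.norm_add_le_max _ _).trans (max_le hαβ ?_)
      rwa [norm_neg, hinv]
  have finish : ∀ (β : L) (B D : ℝ) (a : F), ‖α - β‖ ≤ B → ‖β - algebraMap F L a‖ ≤ D → B ≤ D →
      ‖α - algebraMap F L a‖ ≤ D := by
    intro β B D a h1 h2 hBD
    rw [← sub_add_sub_cancel α β]
    exact (IsUltrametricDist.norm_add_le_max _ _).trans (max_le (h1.trans hBD) h2)
  obtain ⟨k, d, hd, hnk⟩ := Nat.exists_eq_pow_mul_and_not_dvd hn0.ne' p hp.ne_one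
  have hd0 : d ≠ 0 := by rintro rfl; simp at hd
  have hpk : 0 < p ^ k := pow_pos hp.pos k
  rcases eq_or_ne d 1 with rfl | hd1
  · rw [mul_one] at hnk
    cases k with
    | zero =>
      obtain ⟨a, ha⟩ :=
        (minpoly.natDegree_eq_one_iff (A := F) (x := α)).1 (by rw [hn, hnk, pow_zero])
      exact ⟨a, by rw [ha, sub_self, norm_zero]; positivity⟩
    | succ k =>
      obtain ⟨m, hm, hchoose⟩ := exists_choose_prime_pow_succ_eq_mul hp k
      have hpk' : 0 < p ^ k := pow_pos hp.pos k
      have hj : 2 ^ k ≤ p ^ k * (p - 1) := by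
        calc 2 ^ k ≤ p ^ k := Nat.pow_le_pow_left hp.two_le k
          _ ≤ p ^ k * (p - 1) := Nat.le_mul_of_pos_right _ (Nat.sub_pos_of_lt hp.one_lt)
      have hij : p ^ k + p ^ k * (p - 1) = n := by
        rw [hnk, pow_succ, Nat.mul_sub_one,
          Nat.add_sub_cancel' (Nat.le_mul_of_pos_right _ hp.pos)]
      set j := p ^ k * (p - 1)
      have hj0 : j ≠ 0 := ((pow_pos two_pos k).trans_le hj).ne'
      set c : ℝ := (p : ℝ) ^ (1 / 2 ^ k : ℝ) with hc
      have hc1 : 1 ≤ c := Real.one_le_rpow hp1 (by positivity)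
      have hcj : (p : ℝ) ≤ c ^ j := by
        calc (p : ℝ) = c ^ (2 ^ k) := by
              rw [hc, ← Real.rpow_natCast, ← Real.rpow_mul hp0.le]; simp
          _ ≤ c ^ j := pow_le_pow_right₀ hc1 hj
      obtain ⟨β, h1, h2, h3⟩ := step _ j hij hj0 (c * δ) (le_mul_of_one_le_left hδ hc1) (by
        rw [hnk, hchoose, Nat.cast_mul, norm_mul, hnorm m hm, mul_one, hnorm_p, mul_pow,
          ← mul_assoc]
        refine le_mul_of_one_le_left (pow_nonneg hδ j) ?_
        rw [inv_mul_eq_div]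
        exact (one_le_div hp0).2 hcj)
      have hlt : (minpoly F β).natDegree < n := by omega
      obtain ⟨a, ha⟩ := ih _ hlt β (mul_nonneg (zero_le_one.trans hc1) hδ) h3 rfl
      have hlog : Nat.log p (minpoly F β).natDegree ≤ k :=
        Nat.lt_succ_iff.1 (Nat.log_lt_of_lt_pow (minpoly.natDegree_pos
          (Algebra.IsIntegral.isIntegral β)).ne' (hnk ▸ hlt))
      have hcδ : 0 ≤ c * δ := by positivity
      refine ⟨a, (finish β _ _ a h1 (ha.trans
        (mul_le_mul_of_nonneg_right (hmono _ _ hlog) hcδ))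
        (le_mul_of_one_le_left hcδ (hone k))).trans_eq ?_⟩
      rw [hnk, Nat.log_pow hp.one_lt, ← mul_assoc, hc, ← Real.rpow_add hp0]
      congr 2
      field_simp
      ring
  · have hi : p ^ k < n := by
      rw [hnk]
      exact lt_mul_of_one_lt_right hpk (by omega)
    obtain ⟨β, h1, h2, h3⟩ := step (p ^ k) (n - p ^ k) (by omega) (by omega) δ le_rfl (by
      rw [hnorm _ (hnk ▸ not_dvd_choose_prime_pow_mul hp k d hd), one_mul])
    have hlt : (minpoly F β).natDegree < n := by omega
    obtain ⟨a, ha⟩ := ih _ hlt β hδ h3 rfl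
    exact ⟨a, finish β _ _ a h1 (ha.trans (mul_le_mul_of_nonneg_right
      (hmono _ _ (Nat.log_mono_right hlt.le)) hδ)) (le_mul_of_one_le_left hδ (hone _))⟩

end Ultrametric


/-- Ax–Sen–Tate: for `K` a finite extension of `ℚ_p`, `C` the completion of an algebraic
closure `K̄` of `K` (formalized as a complete nonarchimedean normed field together with a
dense isometric embedding `ι : K̄ → C` extending the `p`-adic norm), with the action of
`G_K = Gal(K̄/K)` on `C` given by the unique continuous extension `ρ` of the Galois action
on `K̄`: for every closed subgroup `H ≤ G_K` (Krull topology), the fixed field `C^H` is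
the closure of `K̄^H` in `C`, i.e. `C^H` is the completion of `K̄^H`. -/
theorem completion_fixed_field_eq_closure_of_fixed_field (p : ℕ) [Fact p.Prime]
    (K : Type*) [Field K] [Algebra ℚ_[p] K] [FiniteDimensional ℚ_[p] K]
    (C : Type*) [NormedField C] [CompleteSpace C] [IsUltrametricDist C]
    (ι : AlgebraicClosure K →+* C) (hdense : DenseRange ι)
    (hext : ∀ a : ℚ_[p],
      ‖ι (algebraMap K (AlgebraicClosure K) (algebraMap ℚ_[p] K a))‖ = ‖a‖)
    (ρ : (AlgebraicClosure K ≃ₐ[K] AlgebraicClosure K) →* (C ≃+* C))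
    (hcont : ∀ σ, Continuous (ρ σ))
    (hcompat : ∀ σ x, ρ σ (ι x) = ι (σ x))
    (H : Subgroup (AlgebraicClosure K ≃ₐ[K] AlgebraicClosure K))
    (hH : IsClosed (H : Set (AlgebraicClosure K ≃ₐ[K] AlgebraicClosure K))) :
    {x : C | ∀ σ ∈ H, ρ σ x = x} =
      closure (ι '' (IntermediateField.fixedField H : Set (AlgebraicClosure K))) := by
  have hp : p.Prime := Fact.out
  have : CharZero K := charZero_of_injective_algebraMap (algebraMap ℚ_[p] K).injective
  have : Algebra.IsAlgebraic ℚ_[p] (AlgebraicClosure K) := Algebra.IsAlgebraic.trans _ K _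
  let : NormedField (AlgebraicClosure K) :=
    NormedField.induced (AlgebraicClosure K) C ι ι.injective
  have hnormι : ∀ x : AlgebraicClosure K, ‖ι x‖ = ‖x‖ := fun _ ↦ rfl
  have : IsUltrametricDist (AlgebraicClosure K) :=
    IsUltrametricDist.isUltrametricDist_of_forall_norm_add_le_max_norm fun x y ↦ by
      simpa only [← hnormι, map_add] using IsUltrametricDist.norm_add_le_max (ι x) (ι y)
  have hnorm : ∀ a : ℚ_[p], ‖algebraMap ℚ_[p] (AlgebraicClosure K) a‖ = ‖a‖ := fun a ↦ by
    rw [IsScalarTower.algebraMap_apply ℚ_[p] K, ← hnormι, hext]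
  let : NormedAlgebra ℚ_[p] (AlgebraicClosure K) :=
    { norm_smul_le := fun a x ↦ by rw [Algebra.smul_def, norm_mul, hnorm] }
  have hnat : ∀ m : ℕ, ‖(m : AlgebraicClosure K)‖ = ‖(m : ℚ_[p])‖ := fun m ↦ by
    rw [← hnorm, map_natCast]
  have hinv : ∀ (σ : AlgebraicClosure K ≃ₐ[K] AlgebraicClosure K) x, ‖σ x‖ = ‖x‖ := by
    intro σ x
    rw [NormedAlgebra.norm_eq_spectralNorm ℚ_[p], NormedAlgebra.norm_eq_spectralNorm ℚ_[p]]
    exact (spectralNorm_eq_of_equiv (σ.restrictScalars ℚ_[p]) x).symm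
  have hρ : ∀ σ y, ‖ρ σ y‖ = ‖y‖ := fun σ ↦ congrFun <|
    hdense.equalizer (hcont σ).norm continuous_norm <| funext fun y ↦ by
      simp only [Function.comp_apply, hcompat, hnormι, hinv]
  set F := IntermediateField.fixedField H
  have hmem : ∀ σ : AlgebraicClosure K ≃ₐ[F] AlgebraicClosure K, σ.restrictScalars K ∈ H := by
    intro σ
    have := InfiniteGalois.fixingSubgroup_fixedField (⟨H, hH⟩ : ClosedSubgroup _)
    change σ.restrictScalars K ∈ (⟨H, hH⟩ : ClosedSubgroup _).1
    rw [← this, IntermediateField.mem_fixingSubgroup_iff]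
    exact fun x hx ↦ σ.commutes ⟨x, hx⟩
  refine Set.Subset.antisymm (fun x hx ↦ Metric.mem_closure_iff.2 fun ε hε ↦ ?_) ?_
  · have hp0 : (0 : ℝ) < p := by exact_mod_cast hp.pos
    have hp1 : (1 : ℝ) ≤ p := by exact_mod_cast hp.one_le
    have hD : (1 : ℝ) ≤ (p : ℝ) ^ (2 : ℝ) := Real.one_le_rpow hp1 zero_le_two
    obtain ⟨δ, hδ, hδε⟩ : ∃ δ : ℝ, 0 < δ ∧ (p : ℝ) ^ (2 : ℝ) * δ < ε := by
      refine ⟨ε / 2 / (p : ℝ) ^ (2 : ℝ), by positivity, ?_⟩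
      rw [mul_div_cancel₀ _ (by positivity)]
      exact half_lt_self hε
    obtain ⟨α, hα⟩ := hdense.exists_dist_lt x hδ
    rw [dist_eq_norm] at hα
    have hmove : ∀ σ : AlgebraicClosure K ≃ₐ[F] AlgebraicClosure K, ‖σ α - α‖ ≤ δ := by
      intro σ
      set τ := σ.restrictScalars K
      have hτ : ‖ι (τ α) - x‖ ≤ δ := by
        rw [← hcompat, ← hx τ (hmem σ), ← map_sub, hρ, norm_sub_rev]
        exact hα.le
      rw [← hnormι, map_sub, ← sub_add_sub_cancel _ x]
      exact (IsUltrametricDist.norm_add_le_max _ _).trans (max_le hτ hα.le)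
    obtain ⟨a, ha⟩ := exists_norm_sub_algebraMap_le (F := F) hp (by rw [hnat, Padic.norm_p])
      (fun m hm ↦ by
        rw [hnat, Padic.norm_natCast_eq_one_iff]
        exact (Nat.Prime.coprime_iff_not_dvd hp).2 hm)
      (fun σ y ↦ hinv (σ.restrictScalars K) y) α hδ.le hmove
    refine ⟨ι (a : AlgebraicClosure K), ⟨a, a.2, rfl⟩, ?_⟩
    rw [dist_eq_norm, ← sub_add_sub_cancel _ (ι α)]
    refine (IsUltrametricDist.norm_add_le_max _ _).trans_lt (max_lt ?_ ?_)
    · exact hα.trans ((le_mul_of_one_le_left hδ.le hD).trans_lt hδε)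
    · rw [← map_sub, hnormι]
      refine (ha.trans (mul_le_mul_of_nonneg_right ?_ hδ.le)).trans_lt hδε
      exact Real.rpow_le_rpow_of_exponent_le hp1 (sub_le_self _ (by positivity))
  · refine closure_minimal ?_ ?_
    · rintro _ ⟨x, hx, rfl⟩ σ hσ
      rw [hcompat]
      exact congrArg ι ((IntermediateField.mem_fixedField_iff H x).1 hx σ hσ)
    · simp only [Set.ofPred_forall]
      exact isClosed_iInter fun σ ↦ isClosed_iInter fun _ ↦ isClosed_eq (hcont σ) continuous_id
end

section
/- Fix a prime p and a finite extension K of ℚ_p, with algebraic closure K̄ and C the completion of K̄; the Galois group G_K = Gal(K̄/K) acts on C by the continuous extension of its isometric action on K̄. Fix a compatible system of primitive p^n-th roots of unity ε^{(n)} ∈ K̄ (ε^{(0)} = 1, ε^{(1)} ≠ 1, (ε^{(n+1)})^p = ε^{(n)}); let K_∞ = ∪_n K(ε^{(n)}), H_K = Gal(K̄/K_∞), and Γ_K = Gal(K_∞/K). Let ψ : G_K → ℤ_p^× be a continuous homomorphism which is trivial on H_K and which does not factor through any finite quotient of Γ_K. Then { x ∈ C : g(x) = ψ(g)·x for all g ∈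 G_K } = {0}. In particular, C contains no nonzero period of the cyclotomic character. -/
section CyclotomicTrace

open Polynomial

variable {p : ℕ} [Fact p.Prime] {F : Type*} [NormedField F]

lemma IsPrimitiveRoot.norm_sub_one_pow_totient [NormedAlgebra ℚ_[p] F] [IsUltrametricDist F]
    {m : ℕ} {ζ : F} (hζ : IsPrimitiveRoot ζ (p ^ (m + 1))) :
    ‖ζ - 1‖ ^ (p ^ (m + 1)).totient = (p : ℝ)⁻¹ := by
  have hp : p ≠ 0 := (Fact.out : p.Prime).ne_zero
  have : NeZero (p ^ (m + 1)) := ⟨pow_ne_zero _ hp⟩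
  have key : ∀ {a b : F}, IsPrimitiveRoot a (p ^ (m + 1)) → b ^ (p ^ (m + 1)) = 1 →
      ‖b - 1‖ ≤ ‖a - 1‖ := by
    intro a b ha hb
    obtain ⟨i, -, rfl⟩ := ha.eq_pow_of_pow_eq_one hb
    have hn : ‖a‖ = 1 := by
      have := congrArg norm ha.pow_eq_one
      rw [norm_pow, norm_one] at this
      exact (pow_eq_one_iff_of_nonneg (norm_nonneg _) (pow_ne_zero _ hp)).1 this
    rw [← geom_sum_mul, norm_mul]
    refine mul_le_of_le_one_left (norm_nonneg _) ?_
    refine IsUltrametricDist.norm_sum_le_of_forall_le_of_nonneg zero_le_one fun j _ => ?_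
    simp [hn]
  have h1 := eval_one_cyclotomic_prime_pow (R := F) (p := p) m
  rw [cyclotomic_eq_prod_X_sub_primitiveRoots hζ, eval_prod] at h1
  have h2 := congrArg norm h1
  rw [norm_prod] at h2
  have h3 : ∀ x ∈ primitiveRoots (p ^ (m + 1)) F, ‖eval 1 (X - C x)‖ = ‖ζ - 1‖ := by
    intro x hx
    have hx' := isPrimitiveRoot_of_mem_primitiveRoots hx
    simp only [eval_sub, eval_X, eval_C, norm_sub_rev 1 x]
    exact le_antisymm (key hζ hx'.pow_eq_one) (key hx' hζ.pow_eq_one)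
  rw [Finset.prod_congr rfl h3, Finset.prod_const, hζ.card_primitiveRoots] at h2
  rw [h2, ← map_natCast (algebraMap ℚ_[p] F), norm_algebraMap', Padic.norm_p]

lemma IsPrimitiveRoot.norm_coeff_le_mul_norm_aeval [NormedAlgebra ℚ_[p] F] [IsUltrametricDist F]
    {m : ℕ} {ζ : F} (hζ : IsPrimitiveRoot ζ (p ^ (m + 1))) {r : ℚ_[p][X]}
    (hr : r.natDegree < (p ^ (m + 1)).totient) (i : ℕ) :
    ‖r.coeff i‖ ≤ p * ‖aeval ζ r‖ := by
  have hp : p.Prime := Fact.out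
  have hp1 : (1 : ℝ) < p := by exact_mod_cast hp.one_lt
  have hp0 : (0 : ℝ) < p := by positivity
  set d := (p ^ (m + 1)).totient with hd
  have hpi := hζ.norm_sub_one_pow_totient
  rw [← hd] at hpi
  set π := ζ - 1 with hπ
  have hd0 : d ≠ 0 := by omega
  have hπ0 : 0 < ‖π‖ := by
    rw [norm_pos_iff]
    intro h
    rw [h, norm_zero, zero_pow hd0] at hpi
    exact (inv_pos.2 hp0).ne hpi
  have hπ1 : ‖π‖ ≤ 1 := by
    by_contra h
    have := one_lt_pow₀ (not_le.1 h) hd0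
    rw [hpi] at this
    exact absurd this (not_lt.2 (inv_le_one_of_one_le₀ hp1.le))
  set b := taylor 1 r with hb
  have hbdeg : b.natDegree < d := by rwa [hb, natDegree_taylor]
  have hrb : aeval ζ r = ∑ j ∈ Finset.range d, b.coeff j • π ^ j := by
    rw [← aeval_eq_sum_range' hbdeg, hb, taylor_apply, aeval_comp]
    simp [hπ]
  have hdist : ((b.support : Finset ℕ) : Set ℕ).Pairwise
      fun j k => ‖b.coeff j • π ^ j‖ ≠ ‖b.coeff k • π ^ k‖ := by
    intro j hj k hk hjk h
    have hj0 : b.coeff j ≠ 0 := by simpa using hj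
    have hk0 : b.coeff k ≠ 0 := by simpa using hk
    have hjd : j < d := (le_natDegree_of_ne_zero hj0).trans_lt hbdeg
    have hkd : k < d := (le_natDegree_of_ne_zero hk0).trans_lt hbdeg
    have h := congrArg (· ^ d) h
    simp only [norm_smul, norm_pow, mul_pow, ← pow_mul] at h
    rw [mul_comm j, mul_comm k, pow_mul, pow_mul, hpi, Padic.norm_eq_zpow_neg_valuation hj0,
      Padic.norm_eq_zpow_neg_valuation hk0] at h
    simp only [← zpow_natCast, ← zpow_neg_one, ← zpow_mul] at h
    rw [← zpow_add₀ hp0.ne', ← zpow_add₀ hp0.ne'] at h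
    have h := zpow_right_injective₀ hp0 hp1.ne' h
    have h2 : ((j : ℤ) - k) = d * ((b.coeff k).valuation - (b.coeff j).valuation) := by
      linear_combination -h
    have h3 : ((j : ℤ) - k) = 0 :=
      Int.eq_zero_of_abs_lt_dvd ⟨_, h2⟩ (by rw [abs_lt]; constructor <;> omega)
    exact hjk (by omega)
  have hbj : ∀ j, ‖b.coeff j‖ ≤ p * ‖aeval ζ r‖ := by
    intro j
    by_cases hj0 : b.coeff j = 0
    · rw [hj0, norm_zero]; positivity
    have hjd : j < d := (le_natDegree_of_ne_zero hj0).trans_lt hbdeg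
    have hjs : j ∈ b.support := by simpa using hj0
    have h1 : aeval ζ r = ∑ j ∈ b.support, b.coeff j • π ^ j := by
      rw [hrb]
      symm
      refine Finset.sum_subset (fun k hk => ?_) (fun k _ hk => ?_)
      · rw [Finset.mem_range]
        exact (le_natDegree_of_mem_supp _ hk).trans_lt hbdeg
      · rw [notMem_support_iff.1 hk, zero_smul]
    have h2 : ‖b.coeff j • π ^ j‖ ≤ ‖aeval ζ r‖ := by
      rw [h1, IsUltrametricDist.norm_sum_eq_sup'_of_pairwise_ne ⟨j, hjs⟩ hdist]
      exact Finset.le_sup' (fun i => ‖b.coeff i • π ^ i‖) hjs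
    have h3 : (p : ℝ)⁻¹ ≤ ‖π‖ ^ j := by
      rw [← hpi]
      exact pow_le_pow_of_le_one hπ0.le hπ1 hjd.le
    rw [norm_smul, norm_pow] at h2
    calc ‖b.coeff j‖ = p * (‖b.coeff j‖ * (p : ℝ)⁻¹) := by field_simp
      _ ≤ p * (‖b.coeff j‖ * ‖π‖ ^ j) := by gcongr
      _ ≤ p * ‖aeval ζ r‖ := by gcongr
  have hri : r.coeff i = ∑ j ∈ b.support, b.coeff j * ((X - 1 : ℚ_[p][X]) ^ j).coeff i := by
    conv_lhs => rw [← sum_taylor_eq r 1]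
    rw [← hb, Polynomial.sum, finsetSum_coeff]
    simp
  rw [hri]
  refine IsUltrametricDist.norm_sum_le_of_forall_le_of_nonneg (by positivity) fun j _ => ?_
  rw [norm_mul]
  refine (mul_le_of_le_one_right (norm_nonneg _) ?_).trans (hbj j)
  have : ((X - 1 : ℚ_[p][X]) ^ j) = ((X - 1 : ℤ[X]) ^ j).map (Int.castRingHom ℚ_[p]) := by simp
  rw [this, coeff_map]
  exact Padic.norm_int_le_one _

lemma IsPrimitiveRoot.norm_aeval_contract_le [NormedAlgebra ℚ_[p] F] [IsUltrametricDist F]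
    {n k : ℕ} {ζ : F} (hζ : IsPrimitiveRoot ζ (p ^ (n + 1 + k))) (f : ℚ_[p][X]) :
    ‖aeval (ζ ^ p ^ k) (contract (p ^ k) f)‖ ≤ p * ‖aeval ζ f‖ := by
  have hp : p.Prime := Fact.out
  have hs : p ^ k ≠ 0 := pow_ne_zero _ hp.ne_zero
  have : NeZero (p ^ k) := ⟨hs⟩
  have hζ' : IsPrimitiveRoot (ζ ^ p ^ k) (p ^ (n + 1)) :=
    hζ.pow (pow_pos hp.pos _) (by rw [← pow_add, add_comm k])
  have hexp : ∀ j, expand ℚ_[p] (p ^ j) (cyclotomic (p ^ (n + 1)) ℚ_[p]) =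
      cyclotomic (p ^ (n + 1 + j)) ℚ_[p] := by
    intro j
    induction j with
    | zero => simp
    | succ j ih =>
      rw [pow_succ', ← expand_expand, ih, cyclotomic_expand_eq_cyclotomic hp
        (dvd_pow_self p (by omega)), ← pow_succ, add_assoc]
  have hroot : ∀ {j : ℕ} {z : F}, IsPrimitiveRoot z (p ^ j) →
      aeval z (cyclotomic (p ^ j) ℚ_[p]) = 0 := by
    intro j z hz
    rw [aeval_def, ← eval_map, map_cyclotomic]
    exact hz.isRoot_cyclotomic (pow_pos hp.pos _)
  set Φ := cyclotomic (p ^ (n + 1 + k)) ℚ_[p] with hΦ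
  have hmonic : Φ.Monic := cyclotomic.monic _ _
  set r := f %ₘ Φ with hr
  have hdeg : r.natDegree < (p ^ (n + k + 1)).totient := by
    have := natDegree_modByMonic_lt f hmonic (by
      rw [Ne, ← hmonic.natDegree_eq_zero, hΦ, natDegree_cyclotomic]
      exact (Nat.totient_pos.2 (pow_pos hp.pos _)).ne')
    rwa [hΦ, natDegree_cyclotomic, ← hΦ, add_right_comm] at this
  have hf : f = r + (f /ₘ Φ) * expand ℚ_[p] (p ^ k) (cyclotomic (p ^ (n + 1)) ℚ_[p]) := by
    rw [hexp, mul_comm]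
    exact (modByMonic_add_div f Φ).symm
  have h1 : aeval ζ f = aeval ζ r := by
    rw [hf, hexp, map_add, map_mul, hroot hζ, mul_zero, add_zero]
  have h2 : aeval (ζ ^ p ^ k) (contract (p ^ k) f) = aeval (ζ ^ p ^ k) (contract (p ^ k) r) := by
    conv_lhs => rw [hf]
    rw [contract_add hs, contract_mul_expand hs, map_add, map_mul, hroot hζ', mul_zero, add_zero]
  rw [h1, h2, aeval_eq_sum_range]
  have hζ1 : ‖ζ‖ = 1 := by
    have := congrArg norm hζ.pow_eq_one
    rw [norm_pow, norm_one] at this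
    exact (pow_eq_one_iff_of_nonneg (norm_nonneg _) (pow_ne_zero _ hp.ne_zero)).1 this
  refine IsUltrametricDist.norm_sum_le_of_forall_le_of_nonneg (by positivity) fun j _ => ?_
  rw [norm_smul, norm_pow, norm_pow, hζ1, one_pow, one_pow, mul_one, coeff_contract hs]
  rw [add_right_comm] at hζ
  exact hζ.norm_coeff_le_mul_norm_aeval hdeg _

end CyclotomicTrace

section CyclotomicPeriods

open Polynomial

variable {p : ℕ} [Fact p.Prime] {F : Type*} [NormedField F] [NormedAlgebra ℚ_[p] F]
  [IsUltrametricDist F]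

open Classical in
lemma norm_linearCombination_ite_le {ζ : ℕ → F} (hζ : ∀ n, IsPrimitiveRoot (ζ n) (p ^ n)) (n : ℕ)
    (f : {u : F // ∃ k, u ^ p ^ k = 1} →₀ ℚ_[p]) :
    ‖Finsupp.linearCombination ℚ_[p]
        (fun u : {u : F // ∃ k, u ^ p ^ k = 1} => if (u : F) ^ p ^ (n + 1) = 1 then (u : F) else 0) f‖
      ≤ p * ‖Finsupp.linearCombination ℚ_[p] Subtype.val f‖ := by
  have hp : p.Prime := Fact.out
  have hk : ∃ k, ∀ u ∈ f.support, (u : F) ^ p ^ (n + 1 + k) = 1 := by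
    choose e he using fun u : {u : F // ∃ k, u ^ p ^ k = 1} => u.2
    refine ⟨f.support.sup e, fun u hu => ?_⟩
    obtain ⟨t, ht⟩ := Nat.exists_eq_add_of_le
      (show e u ≤ n + 1 + f.support.sup e from (Finset.le_sup hu).trans (by omega))
    rw [ht, pow_add, pow_mul, he, one_pow]
  obtain ⟨k, hk⟩ := hk
  have hz := hζ (n + 1 + k)
  set z := ζ (n + 1 + k)
  have : NeZero (p ^ (n + 1 + k)) := ⟨pow_ne_zero _ hp.ne_zero⟩
  have hs : p ^ k ≠ 0 := pow_ne_zero _ hp.ne_zero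
  have he : ∀ u : {u : F // ∃ k, u ^ p ^ k = 1}, ∃ i, u ∈ f.support → z ^ i = u := by
    intro u
    by_cases hu : u ∈ f.support
    · obtain ⟨i, -, hi⟩ := hz.eq_pow_of_pow_eq_one (hk u hu)
      exact ⟨i, fun _ => hi⟩
    · exact ⟨0, fun h => absurd h hu⟩
  choose e he using he
  set P : ℚ_[p][X] := ∑ u ∈ f.support, monomial (e u) (f u) with hP
  have h1 : Finsupp.linearCombination ℚ_[p] Subtype.val f = aeval z P := by
    rw [Finsupp.linearCombination_apply, Finsupp.sum, hP, map_sum]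
    refine Finset.sum_congr rfl fun u hu => ?_
    rw [aeval_monomial, he u hu, Algebra.smul_def]
  have hcm : ∀ (i : ℕ) (a : ℚ_[p]), contract (p ^ k) (monomial i a) =
      if p ^ k ∣ i then monomial (i / p ^ k) a else 0 := by
    intro i a
    ext j
    rw [coeff_contract hs, coeff_monomial]
    split_ifs with h1 h2 h2
    · subst h1
      simp [Nat.mul_div_cancel _ (Nat.pos_of_ne_zero hs)]
    · exact absurd ⟨j, by rw [h1, mul_comm]⟩ h2
    · rw [coeff_monomial, if_neg]
      rintro rfl
      exact h1 (Nat.div_mul_cancel h2).symm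
    · simp
  have hcs : ∀ s : Finset {u : F // ∃ k, u ^ p ^ k = 1},
      contract (p ^ k) (∑ u ∈ s, monomial (e u) (f u)) =
        ∑ u ∈ s, contract (p ^ k) (monomial (e u) (f u)) := by
    intro s
    induction s using Finset.induction_on with
    | empty => simp [contract]
    | insert a s ha ih => rw [Finset.sum_insert ha, Finset.sum_insert ha, contract_add hs, ih]
  have h2 : Finsupp.linearCombination ℚ_[p]
        (fun u : {u : F // ∃ k, u ^ p ^ k = 1} => if (u : F) ^ p ^ (n + 1) = 1 then (u : F) else 0) f
      = aeval (z ^ p ^ k) (contract (p ^ k) P) := by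
    rw [Finsupp.linearCombination_apply, Finsupp.sum, hP, hcs, map_sum]
    refine Finset.sum_congr rfl fun u hu => ?_
    have hiff : (u : F) ^ p ^ (n + 1) = 1 ↔ p ^ k ∣ e u := by
      rw [← he u hu, ← pow_mul, hz.pow_eq_one_iff_dvd, add_comm (n + 1), pow_add,
        Nat.mul_dvd_mul_iff_right (pow_pos hp.pos _)]
    rw [hcm]
    by_cases h : p ^ k ∣ e u
    · rw [if_pos (hiff.2 h), if_pos h, aeval_monomial, ← pow_mul, Nat.mul_div_cancel' h, he u hu,
        Algebra.smul_def]
    · rw [if_neg (mt hiff.1 h), if_neg h, smul_zero, map_zero]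
  rw [h1, h2]
  exact hz.norm_aeval_contract_le P

lemma exists_eq_one_of_apply_eq_smul {ζ : ℕ → F} (hζ : ∀ n, IsPrimitiveRoot (ζ n) (p ^ n)) {x : F}
    (hx : x ∈ closure (Submodule.span ℚ_[p] {u : F | ∃ k, u ^ p ^ k = 1} : Set F)) (hx0 : x ≠ 0) :
    ∃ n, ∀ (g : F →ₐ[ℚ_[p]] F), (∀ y, ‖g y‖ = ‖y‖) → g (ζ n) = ζ n →
      ∀ c : ℚ_[p], ‖c‖ ≤ 1 → g x = c • x → c = 1 := by
  classical
  have hp : p.Prime := Fact.out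
  have hp1 : (1 : ℝ) < p := by exact_mod_cast hp.one_lt
  have hp0 : (0 : ℝ) < p := by positivity
  have hxn : 0 < ‖x‖ := norm_pos_iff.2 hx0
  set μ := {u : F // ∃ k, u ^ p ^ k = 1}
  set T : (μ →₀ ℚ_[p]) →ₗ[ℚ_[p]] F := Finsupp.linearCombination ℚ_[p] Subtype.val with hT
  have happrox : ∀ δ > 0, ∃ f, ‖x - T f‖ < δ := by
    intro δ hδ
    obtain ⟨z, hz, hzx⟩ := Metric.mem_closure_iff.1 hx δ hδ
    rw [dist_eq_norm] at hzx
    have : {u : F | ∃ k, u ^ p ^ k = 1} = Set.range (Subtype.val : μ → F) :=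
      Subtype.range_val.symm
    rw [this, SetLike.mem_coe, ← Finsupp.range_linearCombination] at hz
    obtain ⟨f, rfl⟩ := hz
    exact ⟨f, hzx⟩
  obtain ⟨f₀, hf₀⟩ := happrox (‖x‖ / p) (by positivity)
  have hn : ∃ n, ∀ u ∈ f₀.support, (u : F) ^ p ^ (n + 1) = 1 := by
    choose e he using fun u : μ => u.2
    refine ⟨f₀.support.sup e, fun u hu => ?_⟩
    obtain ⟨t, ht⟩ := Nat.exists_eq_add_of_le
      (show e u ≤ f₀.support.sup e + 1 from (Finset.le_sup hu).trans (by omega))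
    rw [ht, pow_add, pow_mul, he, one_pow]
  obtain ⟨n, hn⟩ := hn
  refine ⟨n + 1, fun g hg hgζ c hc hgx => ?_⟩
  set P : (μ →₀ ℚ_[p]) →ₗ[ℚ_[p]] F := Finsupp.linearCombination ℚ_[p]
        (fun u : μ => if (u : F) ^ p ^ (n + 1) = 1 then (u : F) else 0) with hP
  have hPT : ∀ f, ‖P f‖ ≤ p * ‖T f‖ := fun f => norm_linearCombination_ite_le hζ n f
  have hP₀ : P f₀ = T f₀ := by
    rw [hP, hT, Finsupp.linearCombination_apply, Finsupp.linearCombination_apply]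
    exact Finset.sum_congr rfl fun u hu => by simp [hn u hu]
  have hgpow : ∀ {u : F} {k : ℕ}, g u ^ k = 1 ↔ u ^ k = 1 := by
    intro u k
    rw [← map_pow]
    exact ⟨fun h => g.toRingHom.injective (h.trans (map_one g).symm), fun h => by rw [h, map_one]⟩
  let γ : μ → μ := fun u => ⟨g u, u.2.imp fun k hk => hgpow.2 hk⟩
  have hTγ : ∀ f, T (f.mapDomain γ) = g (T f) := by
    intro f
    rw [hT, Finsupp.linearCombination_mapDomain, Finsupp.linearCombination_apply,
      Finsupp.linearCombination_apply, Finsupp.sum, Finsupp.sum, map_sum]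
    exact Finset.sum_congr rfl fun u _ => by simp [γ]
  have hPγ : ∀ f, P (f.mapDomain γ) = P f := by
    intro f
    rw [hP, Finsupp.linearCombination_mapDomain]
    congr 2
    funext u
    simp only [Function.comp, γ, hgpow]
    split_ifs with h
    · have : NeZero (p ^ (n + 1)) := ⟨pow_ne_zero _ hp.ne_zero⟩
      obtain ⟨i, -, hi⟩ := (hζ (n + 1)).eq_pow_of_pow_eq_one h
      rw [← hi, map_pow, hgζ]
    · rfl
  have hsub : ∀ a b : F, ‖a - b‖ ≤ max ‖a‖ ‖b‖ := fun a b => by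
    simpa [sub_eq_add_neg] using IsUltrametricDist.norm_add_le_max a (-b)
  have hnorm : ∀ {a b : F}, ‖b‖ = ‖x‖ → ‖a - b‖ < ‖x‖ → ‖a‖ = ‖x‖ := by
    intro a b hb hab
    rw [← hb]
    rw [← norm_neg b]
    refine IsUltrametricDist.norm_eq_of_add_norm_lt_max ?_
    rw [← sub_eq_add_neg, norm_neg, hb]
    exact hab.trans_le (le_max_right _ _)
  have hT₀ : ‖T f₀‖ = ‖x‖ := by
    refine hnorm rfl ?_
    rw [norm_sub_rev]
    exact hf₀.trans_le (div_le_self hxn.le hp1.le)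
  have key : ∀ δ > 0, δ ≤ ‖x‖ / p → ‖1 - c‖ * ‖x‖ ≤ p * δ := by
    intro δ hδ hδx
    obtain ⟨f, hf⟩ := happrox δ hδ
    have h1 : ‖P f‖ = ‖x‖ := by
      refine hnorm hT₀ ?_
      rw [← hP₀, ← map_sub]
      refine (hPT _).trans_lt ?_
      rw [map_sub, show T f - T f₀ = (x - T f₀) - (x - T f) by ring]
      have := (hsub (x - T f₀) (x - T f)).trans_lt (max_lt hf₀ (hf.trans_le hδx))
      calc p * ‖x - T f₀ - (x - T f)‖ < p * (‖x‖ / p) := by gcongr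
        _ = ‖x‖ := by field_simp
    have h2 : P (f.mapDomain γ - c • f) = (1 - c) • P f := by
      rw [map_sub, hPγ, map_smul, sub_smul, one_smul]
    have h3 : ‖T (f.mapDomain γ - c • f)‖ ≤ δ := by
      rw [map_sub, hTγ, map_smul]
      have : g (T f) - c • T f = c • (x - T f) - g (x - T f) := by
        rw [map_sub, hgx, smul_sub]; ring
      rw [this]
      refine (hsub _ _).trans (max_le ?_ ?_)
      · rw [norm_smul]
        exact (mul_le_of_le_one_left (norm_nonneg _) hc).trans hf.le
      · rw [hg]; exact hf.le
    calc ‖1 - c‖ * ‖x‖ = ‖P (f.mapDomain γ - c • f)‖ := by rw [h2, norm_smul, h1]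
      _ ≤ p * ‖T (f.mapDomain γ - c • f)‖ := hPT _
      _ ≤ p * δ := by gcongr
  by_contra hc1
  have hc0 : 0 < ‖1 - c‖ := norm_pos_iff.2 (sub_ne_zero.2 (Ne.symm hc1))
  have h := key (min (‖x‖ / p) (‖1 - c‖ * ‖x‖ / (2 * p))) (by positivity) (min_le_left _ _)
  have h' : p * min (‖x‖ / p) (‖1 - c‖ * ‖x‖ / (2 * p)) ≤ ‖1 - c‖ * ‖x‖ / 2 := by
    calc _ ≤ p * (‖1 - c‖ * ‖x‖ / (2 * p)) := by gcongr; exact min_le_right _ _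
      _ = _ := by field_simp
  have : 0 < ‖1 - c‖ * ‖x‖ := by positivity
  linarith

end CyclotomicPeriods

section AxSenTate

open Polynomial

variable {p : ℕ} [Fact p.Prime] {Ω : Type*} [NormedField Ω]

lemma Nat.factorization_choose_pow_of_lt {p n k : ℕ} (hp : p.Prime) (h1 : p ^ k < n)
    (h2 : n < p ^ (k + 1)) : (n.choose (p ^ k)).factorization p = 0 := by
  rw [Nat.factorization_choose hp h1.le (Nat.log_lt_of_lt_pow (by omega) h2), Finset.card_eq_zero,
    Finset.filter_eq_empty_iff]
  intro i hi
  rw [Finset.mem_Ico] at hi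
  rw [Nat.mod_eq_zero_of_dvd (pow_dvd_pow p (show i ≤ k by omega)), zero_add, not_le]
  exact Nat.mod_lt _ (pow_pos hp.pos _)

lemma norm_natCast_eq_zpow_neg_factorization [NormedAlgebra ℚ_[p] Ω] {n : ℕ} (hn : n ≠ 0) :
    ‖(n : Ω)‖ = (p : ℝ) ^ (-(n.factorization p : ℤ)) := by
  rw [← map_natCast (algebraMap ℚ_[p] Ω), norm_algebraMap',
    Padic.norm_eq_zpow_neg_valuation (Nat.cast_ne_zero.2 hn), Padic.valuation_natCast,
    Nat.factorization_def _ Fact.out]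

variable [IsUltrametricDist Ω]

lemma norm_coeff_prod_X_sub_C_le (s : Multiset Ω) {δ : ℝ} (hδ : 0 ≤ δ) (hs : ∀ r ∈ s, ‖r‖ ≤ δ)
    {q : ℕ} (hq : q ≤ s.card) :
    ‖(s.map fun r => X - C r).prod.coeff q‖ ≤ δ ^ (s.card - q) := by
  induction s using Multiset.induction_on generalizing q with
  | empty =>
    obtain rfl : q = 0 := by simpa using hq
    simp
  | cons a s ih =>
    have hs' : ∀ r ∈ s, ‖r‖ ≤ δ := fun r hr => hs r (Multiset.mem_cons_of_mem hr)
    have ha : ‖a‖ ≤ δ := hs a (Multiset.mem_cons_self a s)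
    rw [Multiset.map_cons, Multiset.prod_cons, sub_mul, coeff_sub, coeff_C_mul,
      Multiset.card_cons]
    rw [Multiset.card_cons] at hq
    have h2 : ‖a * (s.map fun r => X - C r).prod.coeff q‖ ≤ δ ^ (s.card + 1 - q) := by
      rcases hq.lt_or_eq with h | h
      · rw [norm_mul, show s.card + 1 - q = (s.card - q) + 1 by omega, pow_succ']
        exact mul_le_mul ha (ih hs' (by omega)) (norm_nonneg _) hδ
      · rw [coeff_eq_zero_of_natDegree_lt, mul_zero, norm_zero]
        · positivity
        · rw [natDegree_multiset_prod_X_sub_C_eq_card]; omega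
    have h1 : ‖(X * (s.map fun r => X - C r).prod).coeff q‖ ≤ δ ^ (s.card + 1 - q) := by
      cases q with
      | zero => simp only [coeff_X_mul_zero, norm_zero]; positivity
      | succ q =>
        rw [coeff_X_mul, show s.card + 1 - (q + 1) = s.card - q by omega]
        exact ih hs' (by omega)
    rw [sub_eq_add_neg]
    refine (IsUltrametricDist.norm_add_le_max _ _).trans (max_le h1 ?_)
    rwa [norm_neg]

variable {E : Type*} [Field E] [Algebra E Ω]

lemma exists_norm_sub_pow_mul_norm_choose_le [CharZero E] [IsAlgClosed Ω] [Algebra.IsAlgebraic E Ω]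
    {α : Ω} {δ : ℝ} (hα : ∀ σ : Ω ≃ₐ[E] Ω, ‖σ α - α‖ ≤ δ) {q : ℕ}
    (hq : q < (minpoly E α).natDegree) :
    ∃ β : Ω, (minpoly E β).natDegree ≤ (minpoly E α).natDegree - q ∧
      ‖α - β‖ ^ ((minpoly E α).natDegree - q) * ‖((minpoly E α).natDegree.choose q : Ω)‖ ≤
        δ ^ ((minpoly E α).natDegree - q) := by
  have hδ : 0 ≤ δ := (norm_nonneg _).trans (hα 1)
  have hint : IsIntegral E α := Algebra.IsIntegral.isIntegral α
  set f := minpoly E α with hf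
  have hmonic : f.Monic := minpoly.monic hint
  set n := f.natDegree with hn
  have hnorm : Normal E Ω := normal_iff.2 fun x =>
    ⟨Algebra.IsIntegral.isIntegral x, IsAlgClosed.splits _⟩
  set g := f.map (algebraMap E Ω) with hg
  have hgm : g.Monic := hmonic.map _
  have hgn : g.natDegree = n := natDegree_map _
  have hgs : g.Splits := IsAlgClosed.splits g
  have hcard : g.roots.card = n := by rw [← hgs.natDegree_eq_card_roots, hgn]
  have hroots : ∀ r ∈ g.roots, ‖r - α‖ ≤ δ := by
    intro r hr
    have hr0 : aeval r f = 0 := by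
      rw [aeval_def, ← eval_map]; exact (mem_roots'.1 hr).2
    obtain ⟨σ, rfl⟩ := minpoly.exists_algEquiv_of_root' hint.isAlgebraic hr0
    exact hα σ
  have htay : taylor α g = ((g.roots.map fun r => r - α).map fun r => X - C r).prod := by
    conv_lhs => rw [hgs.eq_prod_roots, hgm.leadingCoeff, C_1, one_mul]
    rw [← taylorAlgHom_apply, map_multiset_prod, Multiset.map_map, Multiset.map_map]
    congr 1
    refine Multiset.map_congr rfl fun r _ => ?_
    simp only [Function.comp, taylorAlgHom_apply, map_sub, taylor_X, taylor_C]
    ring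
  have hval : ‖eval α (hasseDeriv q g)‖ ≤ δ ^ (n - q) := by
    rw [← taylor_coeff, htay]
    have := norm_coeff_prod_X_sub_C_le (g.roots.map fun r => r - α) hδ
      (fun r hr => by
        obtain ⟨x, hx, rfl⟩ := Multiset.mem_map.1 hr
        exact hroots x hx) (q := q) (by rw [Multiset.card_map, hcard]; exact hq.le)
    rwa [Multiset.card_map, hcard] at this
  set h := hasseDeriv q f with hh
  have hmap : hasseDeriv q g = h.map (algebraMap E Ω) := by
    ext i; simp [hh, hg, hasseDeriv_coeff]
  have hdeg : h.natDegree = n - q := natDegree_hasseDeriv f q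
  have hlead : h.leadingCoeff = (n.choose q : E) := by
    rw [leadingCoeff, hdeg, hh, hasseDeriv_coeff, Nat.sub_add_cancel hq.le, hn,
      hmonic.coeff_natDegree, mul_one]
  have hh0 : h ≠ 0 := by
    rw [← leadingCoeff_ne_zero, hlead, Nat.cast_ne_zero]
    exact (Nat.choose_pos hq.le).ne'
  set H := h.map (algebraMap E Ω) with hH
  have hHs : H.Splits := IsAlgClosed.splits H
  have hHcard : H.roots.card = n - q := by
    rw [← hHs.natDegree_eq_card_roots, natDegree_map, hdeg]
  have hne : H.roots ≠ 0 := by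
    rw [← Multiset.card_pos, hHcard]; omega
  obtain ⟨β, hβ, hmin⟩ := Multiset.exists_min_image (fun r => ‖α - r‖) hne
  refine ⟨β, ?_, ?_⟩
  · rw [← hdeg]
    refine natDegree_le_of_dvd (minpoly.dvd E β ?_) hh0
    rw [aeval_def, ← eval_map]
    exact (mem_roots'.1 hβ).2
  · have h1 : ‖eval α H‖ = ‖(n.choose q : Ω)‖ * (H.roots.map fun r => ‖α - r‖).prod := by
      rw [hHs.eval_eq_prod_roots, norm_mul, hH, leadingCoeff_map, hlead, map_natCast, ← hH]
      congr 1
      have := map_multiset_prod (normHom : Ω →*₀ ℝ) (H.roots.map fun r => α - r)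
      rwa [Multiset.map_map] at this
    have h2 : ‖α - β‖ ^ (n - q) ≤ (H.roots.map fun r => ‖α - r‖).prod := by
      rw [← hHcard, ← Multiset.prod_replicate, ← Multiset.map_const']
      exact Multiset.prod_map_le_prod_map₀ _ _ (fun _ _ => norm_nonneg _) hmin
    rw [hmap, h1] at hval
    refine le_trans ?_ hval
    rw [mul_comm]
    gcongr

/-- Ax's theorem. -/
theorem exists_norm_sub_algebraMap_le_s4 [NormedAlgebra ℚ_[p] Ω] [CharZero E] [IsAlgClosed Ω]
    [Algebra.IsAlgebraic E Ω] (hiso : ∀ (σ : Ω ≃ₐ[E] Ω) (x : Ω), ‖σ x‖ = ‖x‖)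
    {α : Ω} {δ : ℝ} (hα : ∀ σ : Ω ≃ₐ[E] Ω, ‖σ α - α‖ ≤ δ) :
    ∃ a : E, ‖α - algebraMap E Ω a‖ ≤ (p : ℝ) ^ 2 * δ := by
  have hp : p.Prime := Fact.out
  have hp1 : (1 : ℝ) < p := by exact_mod_cast hp.one_lt
  have hp0 : (0 : ℝ) < p := by positivity
  have hsub : ∀ a b : Ω, ‖a - b‖ ≤ max ‖a‖ ‖b‖ := fun a b => by
    simpa [sub_eq_add_neg] using IsUltrametricDist.norm_add_le_max a (-b)
  let s : ℕ → ℝ := fun k => 2 - 2 / 2 ^ k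
  have hs_le : ∀ k, s k ≤ 2 := fun k => sub_le_self _ (by positivity)
  have hs_mono : Monotone s := monotone_nat_of_le_succ fun k => by
    simp only [s]
    gcongr
    · norm_num
    · omega
  have hs_succ : ∀ k, s (k + 1) = s k + 1 / 2 ^ k := fun k => by
    simp only [s]; field_simp; ring
  have hs_nonneg : ∀ k, 0 ≤ s k := fun k => by
    have := hs_mono (Nat.zero_le k)
    simpa [s] using this
  suffices H : ∀ n, ∀ (α : Ω) (δ : ℝ), (minpoly E α).natDegree = n →
      (∀ σ : Ω ≃ₐ[E] Ω, ‖σ α - α‖ ≤ δ) →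
      ∃ a : E, ‖α - algebraMap E Ω a‖ ≤ (p : ℝ) ^ s (Nat.log p n) * δ by
    obtain ⟨a, ha⟩ := H _ α δ rfl hα
    have hδ : 0 ≤ δ := (norm_nonneg _).trans (hα 1)
    refine ⟨a, ha.trans ?_⟩
    rw [← Real.rpow_natCast]
    gcongr
    · exact hp1.le
    · exact_mod_cast hs_le _
  intro n
  induction n using Nat.strong_induction_on with
  | _ n ih =>
  intro α δ hn hα
  have hδ : 0 ≤ δ := (norm_nonneg _).trans (hα 1)
  have hint : IsIntegral E α := Algebra.IsIntegral.isIntegral α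
  have hn0 : 0 < n := hn ▸ minpoly.natDegree_pos hint
  rcases Nat.eq_or_lt_of_le (Nat.succ_le_of_lt hn0) with h1 | h1
  · obtain ⟨a, ha⟩ := minpoly.natDegree_eq_one_iff.1 (hn.trans h1.symm)
    refine ⟨a, ?_⟩
    rw [ha, sub_self, norm_zero]
    positivity
  have descend : ∀ {q : ℕ} {δ' : ℝ}, 0 < q → q < n → δ ≤ δ' →
      δ ^ (n - q) ≤ δ' ^ (n - q) * ‖(n.choose q : Ω)‖ →
      ∃ (m : ℕ) (a : E), m ≤ n - q ∧ ‖α - algebraMap E Ω a‖ ≤ (p : ℝ) ^ s (Nat.log p m) * δ' := by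
    intro q δ' hq0 hqn hδδ' hle
    have hδ' : 0 ≤ δ' := hδ.trans hδδ'
    obtain ⟨β, hβ, hβ'⟩ := exists_norm_sub_pow_mul_norm_choose_le hα (q := q) (by omega)
    rw [hn] at hβ hβ'
    have hch : 0 < ‖(n.choose q : Ω)‖ := by
      rw [norm_natCast_eq_zpow_neg_factorization (p := p) (Nat.choose_pos hqn.le).ne']
      positivity
    have hαβ : ‖α - β‖ ≤ δ' :=
      le_of_pow_le_pow_left₀ (by omega) hδ' (le_of_mul_le_mul_right (hβ'.trans hle) hch)
    obtain ⟨a, ha⟩ := ih _ (by omega) β δ' rfl fun σ => by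
      have : σ β - β = (σ α - α) - (σ (α - β) - (α - β)) := by rw [map_sub]; ring
      rw [this]
      refine (hsub _ _).trans (max_le ((hα σ).trans hδδ') ((hsub _ _).trans (max_le ?_ hαβ)))
      rwa [hiso]
    refine ⟨_, a, hβ, ?_⟩
    rw [← sub_add_sub_cancel α β]
    refine (IsUltrametricDist.norm_add_le_max _ _).trans (max_le (hαβ.trans ?_) ha)
    exact le_mul_of_one_le_left hδ' (Real.one_le_rpow hp1.le (hs_nonneg _))
  set k := Nat.log p n with hk
  have hk1 : p ^ k ≤ n := Nat.pow_log_le_self p hn0.ne'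
  have hk2 : n < p ^ (k + 1) := Nat.lt_pow_succ_log_self hp.one_lt n
  rcases hk1.lt_or_eq with hlt | heq
  · obtain ⟨m, a, hm, ha⟩ := descend (pow_pos hp.pos k) hlt le_rfl (by
      rw [norm_natCast_eq_zpow_neg_factorization (p := p) (Nat.choose_pos hk1).ne',
        Nat.factorization_choose_pow_of_lt hp hlt hk2]
      simp)
    refine ⟨a, ha.trans ?_⟩
    gcongr
    · exact hp1.le
    · exact hs_mono (Nat.log_mono_right (by omega))
  · obtain ⟨l, hl⟩ : ∃ l, k = l + 1 := Nat.exists_eq_succ_of_ne_zero (by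
      rintro h0; rw [h0, pow_zero] at heq; omega)
    rw [hl] at heq
    have hq : p ^ l < n := heq ▸ Nat.pow_lt_pow_right hp.one_lt (by omega)
    have hnq : 2 ^ l ≤ n - p ^ l := by
      have : 2 ^ l ≤ p ^ l := Nat.pow_le_pow_left hp.two_le l
      have h3 : p ^ l * 2 ≤ p ^ l * p := Nat.mul_le_mul_left _ hp.two_le
      rw [← pow_succ, heq] at h3
      omega
    obtain ⟨m, a, hm, ha⟩ := descend (δ' := (p : ℝ) ^ ((1 : ℝ) / 2 ^ l) * δ) (pow_pos hp.pos l) hq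
      (le_mul_of_one_le_left hδ (Real.one_le_rpow hp1.le (by positivity))) (by
        rw [norm_natCast_eq_zpow_neg_factorization (p := p) (Nat.choose_pos hq.le).ne']
        have hfac : (n.choose (p ^ l)).factorization p = 1 := by
          rw [← heq, Nat.factorization_choose_prime_pow hp
            (Nat.pow_le_pow_right hp.pos (by omega)) (pow_ne_zero _ hp.ne_zero),
            hp.factorization_pow, Finsupp.single_eq_same]
          omega
        rw [hfac, mul_pow]
        have h4 : (p : ℝ) ≤ ((p : ℝ) ^ ((1 : ℝ) / 2 ^ l)) ^ (n - p ^ l) := by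
          rw [← Real.rpow_natCast, ← Real.rpow_mul hp0.le]
          refine Real.self_le_rpow_of_one_le hp1.le ?_
          rw [div_mul_eq_mul_div, one_mul, le_div_iff₀ (by positivity), one_mul]
          exact_mod_cast hnq
        have h5 : (p : ℝ) ^ (-((1 : ℕ) : ℤ)) = (p : ℝ)⁻¹ := by simp
        rw [h5]
        calc δ ^ (n - p ^ l) = p * δ ^ (n - p ^ l) * (p : ℝ)⁻¹ := by field_simp
          _ ≤ _ := by gcongr)
    refine ⟨a, ha.trans ?_⟩
    rw [← mul_assoc, ← Real.rpow_add hp0]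
    gcongr
    · exact hp1.le
    · rw [hl, hs_succ]
      gcongr
      refine hs_mono (Nat.lt_succ_iff.1 (Nat.log_lt_of_lt_pow' (by omega) ?_))
      rw [heq]
      have := pow_pos hp.pos l
      omega

end AxSenTate

section SemilinearPeriods

lemma RingEquiv.norm_map_of_continuous {p : ℕ} [Fact p.Prime] {F : Type*} [NormedField F]
    [NormedAlgebra ℚ_[p] F] (T : F ≃+* F) (hT : Continuous T) (hT' : Continuous T.symm) (x : F) :
    ‖T x‖ = ‖x‖ := by
  have hp1 : (1 : ℝ) < p := by exact_mod_cast (Fact.out : p.Prime).one_lt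
  have hp0 : (0 : ℝ) < p := by positivity
  have hnp : ‖(p : F)‖ = (p : ℝ)⁻¹ := by
    rw [← map_natCast (algebraMap ℚ_[p] F), norm_algebraMap', Padic.norm_p]
  have key : ∀ (T : F ≃+* F), Continuous T → ∀ x, ‖T x‖ ≤ ‖x‖ := by
    intro T hT x
    have hlt : ∀ y, ‖y‖ < 1 → ‖T y‖ < 1 := by
      intro y hy
      have h := (hT.tendsto 0).comp (tendsto_pow_atTop_nhds_zero_iff_norm_lt_one.2 hy)
      rw [map_zero] at h
      refine tendsto_pow_atTop_nhds_zero_iff_norm_lt_one.1 (h.congr fun n => ?_)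
      simp
    by_contra! hx
    rcases eq_or_ne x 0 with rfl | hx0
    · simp at hx
    have hxn : 0 < ‖x‖ := norm_pos_iff.2 hx0
    obtain ⟨n, hn⟩ := pow_unbounded_of_one_lt (p : ℝ) ((one_lt_div hxn).2 hx)
    obtain ⟨j, hj1, hj2⟩ := exists_mem_Ico_zpow (pow_pos hxn n) hp1
    rw [div_pow, lt_div_iff₀ (pow_pos hxn n)] at hn
    have h1 : ‖x ^ n * (p : F) ^ (j + 1)‖ < 1 := by
      rw [norm_mul, norm_pow, norm_zpow, hnp, inv_zpow, ← div_eq_mul_inv, div_lt_one (by positivity)]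
      exact hj2
    have h2 := hlt _ h1
    rw [map_mul, map_pow, map_zpow₀, map_natCast, norm_mul, norm_pow, norm_zpow, hnp, inv_zpow,
      ← div_eq_mul_inv, div_lt_one (by positivity)] at h2
    have h3 : (p : ℝ) ^ (j + 1) ≤ p * ‖x‖ ^ n := by
      rw [zpow_add_one₀ hp0.ne', mul_comm]
      gcongr
    linarith
  refine le_antisymm (key T hT x) ?_
  simpa using key T.symm hT' (T x)

lemma exists_mem_subfield_apply_eq_mul {G F : Type*} [Field F] (T : G → F →+* F) (L : Subfield F)
    (hL : ∀ g, ∀ y ∈ L, T g y ∈ L) {V : Set F} (hV : ∀ g, ∀ v ∈ V, T g v = v) {c : G → F}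
    (hc : ∀ g, c g ∈ L) {x : F} (hx : x ∈ Submodule.span L V) (hx0 : x ≠ 0)
    (hTx : ∀ g, T g x = c g * x) :
    ∃ y ∈ L, y ≠ 0 ∧ ∀ g, T g y = c g * y := by
  obtain ⟨b, hbV, hspan, hli⟩ := exists_linearIndependent L V
  rw [← hspan, ← Subtype.range_val (s := b), ← Finsupp.range_linearCombination] at hx
  obtain ⟨f, rfl⟩ := hx
  obtain ⟨i, hi⟩ : ∃ i, f i ≠ 0 := by
    by_contra! h
    exact hx0 (by rw [show f = 0 from Finsupp.ext h, map_zero])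
  refine ⟨f i, (f i).2, by simpa using hi, fun g => ?_⟩
  let τ : L →+ L :=
    { toFun := fun y => ⟨T g y, hL g y y.2⟩
      map_zero' := by ext; simp
      map_add' := by intros; ext; simp }
  have h1 : Finsupp.linearCombination L (Subtype.val : b → F) (f.mapRange τ (map_zero τ)) =
      Finsupp.linearCombination L (Subtype.val : b → F) ((⟨c g, hc g⟩ : L) • f) := by
    rw [map_smul, Subfield.smul_def, smul_eq_mul, ← hTx g, Finsupp.linearCombination_apply,
      Finsupp.linearCombination_apply, Finsupp.sum_mapRange_index (by simp), Finsupp.sum,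
      Finsupp.sum, map_sum]
    refine Finset.sum_congr rfl fun v _ => ?_
    simp [Subfield.smul_def, τ, hV g v (hbV v.2)]
  have h2 := DFunLike.congr_fun (hli h1) i
  simpa [τ] using congrArg Subtype.val h2

lemma exists_norm_map_sub_algebraMap_le {p : ℕ} [Fact p.Prime] {E Ω C : Type*} [Field E] [CharZero E]
    [Field Ω] [IsAlgClosed Ω] [Algebra E Ω] [Algebra.IsAlgebraic E Ω] [NormedField C]
    [IsUltrametricDist C] (ι : Ω →+* C) (j : ℚ_[p] →+* Ω) (hj : ∀ a, ‖ι (j a)‖ = ‖a‖)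
    (hiso : ∀ (σ : Ω ≃ₐ[E] Ω) (x : Ω), ‖ι (σ x)‖ = ‖ι x‖)
    {α : Ω} {δ : ℝ} (hα : ∀ σ : Ω ≃ₐ[E] Ω, ‖ι (σ α) - ι α‖ ≤ δ) :
    ∃ a : E, ‖ι α - ι (algebraMap E Ω a)‖ ≤ (p : ℝ) ^ 2 * δ := by
  let : NormedField Ω := NormedField.induced Ω C ι ι.injective
  have hnorm : ∀ x : Ω, ‖x‖ = ‖ι x‖ := fun _ => rfl
  have : IsUltrametricDist Ω :=
    IsUltrametricDist.isUltrametricDist_of_forall_norm_add_le_max_norm fun x y => by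
      simpa only [hnorm, map_add] using IsUltrametricDist.norm_add_le_max (ι x) (ι y)
  let : NormedAlgebra ℚ_[p] Ω :=
    { j.toAlgebra with
      norm_smul_le := fun a x => by
        change ‖j a * x‖ ≤ _
        rw [norm_mul, hnorm (j a), hj] }
  obtain ⟨a, ha⟩ := exists_norm_sub_algebraMap_le_s4 (p := p) (E := E) hiso (α := α) (δ := δ)
    (by simpa only [hnorm, map_sub] using hα)
  exact ⟨a, by simpa only [hnorm, map_sub] using ha⟩

end SemilinearPeriods

section ClosureOfCyclotomicTower

lemma isPrimitiveRoot_of_pow_succ_eq {p : ℕ} [Fact p.Prime] {R : Type*} [CommRing R]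
    {ε : ℕ → R} (h0 : ε 0 = 1) (h1 : ε 1 ≠ 1) (hp : ∀ n, ε (n + 1) ^ p = ε n) (n : ℕ) :
    IsPrimitiveRoot (ε n) (p ^ n) := by
  have hpow : ∀ k n, ε (n + k) ^ p ^ k = ε n := by
    intro k
    induction k with
    | zero => simp
    | succ k ih => intro n; rw [pow_succ', pow_mul, ← add_assoc, hp, ih]
  cases n with
  | zero => rw [h0, pow_zero]; exact IsPrimitiveRoot.one
  | succ n =>
    have : orderOf (ε (n + 1)) = p ^ (n + 1) := by
      refine orderOf_eq_prime_pow ?_ ?_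
      · rw [add_comm, hpow]; exact h1
      · have := hpow (n + 1) 0
        rw [zero_add] at this
        rw [this, h0]
    rw [← this]
    exact IsPrimitiveRoot.orderOf _

/-- The closure of the `ℚ_[p]`-span of the `p`-power roots of unity is a subfield. -/
lemma exists_subfield_eq_closure_span (p : ℕ) [Fact p.Prime] (F : Type*) [NormedField F]
    [NormedAlgebra ℚ_[p] F] :
    ∃ L : Subfield F, (L : Set F) =
      closure (Submodule.span ℚ_[p] {u : F | ∃ k, u ^ p ^ k = 1} : Set F) := by
  have hp : p.Prime := Fact.out
  let μ : Submonoid F :=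
    { carrier := {u : F | ∃ k, u ^ p ^ k = 1}
      one_mem' := ⟨0, by simp⟩
      mul_mem' := by
        rintro a b ⟨k, hk⟩ ⟨l, hl⟩
        refine ⟨k + l, ?_⟩
        rw [mul_pow, pow_add, pow_mul, hk, one_pow, one_mul, mul_comm, pow_mul, hl, one_pow] }
  refine ⟨(IntermediateField.adjoin ℚ_[p] (μ : Set F)).toSubfield.topologicalClosure, ?_⟩
  have hint : ∀ u ∈ (μ : Set F), IsAlgebraic ℚ_[p] u := by
    rintro u ⟨k, hk⟩
    exact (IsIntegral.of_pow (pow_pos hp.pos k) (hk ▸ isIntegral_one)).isAlgebraic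
  have h : ((IntermediateField.adjoin ℚ_[p] (μ : Set F)).toSubfield : Set F) =
      Submodule.span ℚ_[p] (μ : Set F) := by
    have h1 := IntermediateField.adjoin_toSubalgebra_of_isAlgebraic hint
    have h2 := Algebra.adjoin_eq_span ℚ_[p] (μ : Set F)
    rw [Submonoid.closure_eq] at h2
    rw [← h2, ← h1]
    rfl
  change closure _ = _
  exact congrArg closure h

end ClosureOfCyclotomicTower

/-- Tate's theorem: `C` contains no nonzero period for a character which is too ramified.
Let `K` be a finite extension of `ℚ_p`, `C` the completion of an algebraic closure `K̄`
(formalized via a dense isometric embedding `ι : K̄ → C` and the continuous extension `ρ`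
of the Galois action), `ε⁽ⁿ⁾` a compatible system of primitive `p^n`-th roots of unity,
`K_∞ = K(ε⁽¹⁾, ε⁽²⁾, …)` and `H_K = Gal(K̄/K_∞)`.  If `ψ : G_K → ℤ_p^×` is a continuous
character which is trivial on `H_K` but does not factor through a finite quotient of
`Γ_K = G_K/H_K` (equivalently, `ψ` has infinite image), then
`{x ∈ C : g(x) = ψ(g)·x for all g ∈ G_K} = {0}`. -/
theorem tate_no_periods_of_ramified_characters (p : ℕ) [Fact p.Prime]
    (K : Type*) [Field K] [Algebra ℚ_[p] K] [FiniteDimensional ℚ_[p] K]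
    (C : Type*) [NormedField C] [CompleteSpace C] [IsUltrametricDist C]
    (ι : AlgebraicClosure K →+* C) (hdense : DenseRange ι)
    (hext : ∀ a : ℚ_[p],
      ‖ι (algebraMap K (AlgebraicClosure K) (algebraMap ℚ_[p] K a))‖ = ‖a‖)
    (ρ : (AlgebraicClosure K ≃ₐ[K] AlgebraicClosure K) →* (C ≃+* C))
    (hcont : ∀ σ, Continuous (ρ σ))
    (hcompat : ∀ σ x, ρ σ (ι x) = ι (σ x))
    (ε : ℕ → AlgebraicClosure K)
    (hε0 : ε 0 = 1) (hε1 : ε 1 ≠ 1) (hεp : ∀ n, ε (n + 1) ^ p = ε n)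
    (ψ : (AlgebraicClosure K ≃ₐ[K] AlgebraicClosure K) →* ℤ_[p]ˣ)
    (hψcont : Continuous ψ)
    (hψtriv : ∀ σ ∈ (IntermediateField.adjoin K (Set.range ε)).fixingSubgroup, ψ σ = 1)
    (hψinf : (Set.range ψ).Infinite) :
    {x : C | ∀ g : AlgebraicClosure K ≃ₐ[K] AlgebraicClosure K,
        ρ g x = ι (algebraMap K (AlgebraicClosure K)
          (algebraMap ℚ_[p] K ((ψ g : ℤ_[p]) : ℚ_[p]))) * x} = {0} := by
  classical
  have hp : p.Prime := Fact.out
  set j : K →+* C := ι.comp (algebraMap K (AlgebraicClosure K)) with hj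
  let : NormedAlgebra ℚ_[p] C :=
    { (j.comp (algebraMap ℚ_[p] K)).toAlgebra with
      norm_smul_le := fun a x => by
        change ‖j (algebraMap ℚ_[p] K a) * x‖ ≤ _
        rw [norm_mul]
        exact (congrArg (· * ‖x‖) (hext a)).le }
  have halg : ∀ a : ℚ_[p], algebraMap ℚ_[p] C a = j (algebraMap ℚ_[p] K a) := fun _ => rfl
  have hρj : ∀ g a, ρ g (j a) = j a := by
    intro g a
    rw [hj, RingHom.comp_apply, hcompat, AlgEquiv.commutes]
  have hρiso : ∀ g x, ‖ρ g x‖ = ‖x‖ := by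
    intro g x
    refine RingEquiv.norm_map_of_continuous (p := p) (ρ g) (hcont g) ?_ x
    have : (ρ g).symm = ρ g⁻¹ := by rw [map_inv]; rfl
    rw [this]
    exact hcont _
  have hεprim := isPrimitiveRoot_of_pow_succ_eq hε0 hε1 hεp
  have hζ : ∀ n, IsPrimitiveRoot (ι (ε n)) (p ^ n) := fun n =>
    (hεprim n).map_of_injective ι.injective
  have hsub : ∀ a b : C, ‖a - b‖ ≤ max ‖a‖ ‖b‖ := fun a b => by
    simpa [sub_eq_add_neg] using IsUltrametricDist.norm_add_le_max a (-b)
  refine Set.eq_singleton_iff_unique_mem.2 ⟨fun g => by simp, fun x hx => ?_⟩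
  by_contra hx0
  have hx' : ∀ g, ρ g x = algebraMap ℚ_[p] C ((ψ g : ℤ_[p]) : ℚ_[p]) * x := hx
  set E := IntermediateField.adjoin K (Set.range ε) with hE
  have : CharZero K := charZero_of_injective_algebraMap (algebraMap ℚ_[p] K).injective
  have hxE : x ∈ closure (ι '' (E : Set (AlgebraicClosure K))) := by
    refine Metric.mem_closure_iff.2 fun δ hδ => ?_
    have hp0 : (0 : ℝ) < p := by exact_mod_cast hp.pos
    have hp1 : (1 : ℝ) ≤ (p : ℝ) ^ 2 := one_le_pow₀ (by exact_mod_cast hp.one_lt.le)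
    have hη : 0 < δ / (p ^ 2) / 2 := by positivity
    obtain ⟨α, hα⟩ := hdense.exists_dist_lt x hη
    rw [dist_eq_norm] at hα
    obtain ⟨a, ha⟩ := exists_norm_map_sub_algebraMap_le (p := p) (E := E) ι
      ((algebraMap K (AlgebraicClosure K)).comp (algebraMap ℚ_[p] K)) hext
      (fun σ y => by
        have := hρiso (σ.restrictScalars K) (ι y)
        rwa [hcompat] at this)
      (α := α) (δ := δ / (p ^ 2) / 2) (fun σ => by
        have hσ : σ.restrictScalars K ∈ E.fixingSubgroup := by
          rw [IntermediateField.mem_fixingSubgroup_iff]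
          exact fun y hy => σ.commutes ⟨y, hy⟩
        have h1 : ρ (σ.restrictScalars K) x = x := by
          rw [hx', hψtriv _ hσ]
          simp
        have h2 : ι (σ α) - ι α = (x - ι α) - ρ (σ.restrictScalars K) (x - ι α) := by
          rw [map_sub, h1, hcompat]
          simp
        rw [h2]
        refine (hsub _ _).trans (max_le hα.le ?_)
        rw [hρiso]
        exact hα.le)
    refine ⟨_, ⟨_, a.2, rfl⟩, ?_⟩
    rw [dist_eq_norm, ← sub_add_sub_cancel x (ι α)]
    refine (IsUltrametricDist.norm_add_le_max _ _).trans_lt (max_lt ?_ (ha.trans_lt ?_))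
    · refine hα.trans_le ?_
      rw [div_div]
      exact div_le_self hδ.le (by linarith)
    · calc (p : ℝ) ^ 2 * (δ / p ^ 2 / 2) = δ / 2 := by field_simp
        _ < δ := half_lt_self hδ
  obtain ⟨L, hL⟩ := exists_subfield_eq_closure_span p C
  have hLμ : ∀ u : C, (∃ k, u ^ p ^ k = 1) → u ∈ L := fun u hu => by
    rw [← SetLike.mem_coe, hL]
    exact subset_closure (Submodule.subset_span hu)
  have hLalg : ∀ a, algebraMap ℚ_[p] C a ∈ L := fun a => by
    rw [← SetLike.mem_coe, hL, Algebra.algebraMap_eq_smul_one]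
    exact subset_closure (Submodule.smul_mem _ _ (Submodule.subset_span ⟨0, by simp⟩))
  have hLρ : ∀ g, ∀ y ∈ L, ρ g y ∈ L := by
    intro g y hy
    rw [← SetLike.mem_coe, hL] at hy ⊢
    refine map_mem_closure (hcont g) hy fun z hz => ?_
    induction hz using Submodule.span_induction with
    | mem u hu =>
      refine Submodule.subset_span (hu.imp fun k hk => ?_)
      rw [← map_pow, hk, map_one]
    | zero => rw [map_zero]; exact Submodule.zero_mem _
    | add a b _ _ ha hb => rw [map_add]; exact Submodule.add_mem _ ha hb
    | smul r a _ ha =>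
      rw [Algebra.smul_def, map_mul, halg, hρj, ← halg, ← Algebra.smul_def]
      exact Submodule.smul_mem _ _ ha
  have hLclosed : IsClosed (L : Set C) := hL ▸ isClosed_closure
  have : CompleteSpace L := hLclosed.completeSpace_coe
  let : NontriviallyNormedField L :=
    { (inferInstance : NormedField L) with
      non_trivial := ⟨⟨algebraMap ℚ_[p] C (p : ℚ_[p])⁻¹, hLalg _⟩, by
        change 1 < ‖algebraMap ℚ_[p] C (p : ℚ_[p])⁻¹‖
        rw [norm_algebraMap', norm_inv, Padic.norm_p, inv_inv]
        exact_mod_cast hp.one_lt⟩ }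
  have hfin : FiniteDimensional L (Submodule.span L (Set.range j)) := by
    let b := Module.finBasis ℚ_[p] K
    have hle : Submodule.span L (Set.range j) ≤ Submodule.span L (Set.range (j ∘ b)) := by
      rw [Submodule.span_le]
      rintro _ ⟨a, rfl⟩
      rw [← b.sum_repr a, map_sum]
      refine Submodule.sum_mem _ fun i _ => ?_
      rw [Algebra.smul_def, map_mul, ← halg]
      exact Submodule.smul_mem _ (⟨_, hLalg (b.repr a i)⟩ : L) (Submodule.subset_span ⟨i, rfl⟩)
    have := FiniteDimensional.span_of_finite L (Set.finite_range (j ∘ b))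
    exact Submodule.finiteDimensional_of_le hle
  have hxM : x ∈ Submodule.span L (Set.range j) := by
    have hclosed := Submodule.closed_of_finiteDimensional (Submodule.span L (Set.range j))
    rw [← SetLike.mem_coe, ← hclosed.closure_eq]
    refine closure_mono ?_ hxE
    rintro _ ⟨y, hy, rfl⟩
    rw [SetLike.mem_coe, ← IntermediateField.mem_toSubalgebra, hE,
      IntermediateField.adjoin_toSubalgebra, ← Subalgebra.mem_toSubmodule,
      Algebra.adjoin_eq_span] at hy
    induction hy using Submodule.closure_induction with
    | zero => rw [map_zero]; exact Submodule.zero_mem _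
    | add a b _ _ ha hb => rw [map_add]; exact Submodule.add_mem _ ha hb
    | smul_mem r u hu =>
      have huL : ι u ∈ L := by
        induction hu using Submonoid.closure_induction with
        | mem v hv =>
          obtain ⟨k, rfl⟩ := hv
          exact hLμ _ ⟨k, (hζ k).pow_eq_one⟩
        | one => rw [map_one]; exact L.one_mem
        | mul a b _ _ ha hb => rw [map_mul]; exact L.mul_mem ha hb
      rw [Algebra.smul_def, map_mul, mul_comm]
      exact Submodule.smul_mem _ (⟨_, huL⟩ : L) (Submodule.subset_span ⟨r, rfl⟩)
  obtain ⟨y, hyL, hy0, hy⟩ := exists_mem_subfield_apply_eq_mul (fun g => (ρ g : C →+* C)) L hLρ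
    (V := Set.range j) (by rintro g _ ⟨a, rfl⟩; exact hρj g a)
    (fun g => hLalg ((ψ g : ℤ_[p]) : ℚ_[p])) hxM hx0 hx'
  rw [← SetLike.mem_coe, hL] at hyL
  obtain ⟨n, hn⟩ := exists_eq_one_of_apply_eq_smul hζ hyL hy0
  have hker : ∀ g, g (ε n) = ε n → ψ g = 1 := by
    intro g hg
    have := hn { (ρ g : C →+* C) with commutes' := fun a => hρj g _ } (hρiso g)
      (by change ρ g _ = _; rw [hcompat, hg]) ((ψ g : ℤ_[p]) : ℚ_[p]) (PadicInt.norm_le_one _)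
      (by rw [Algebra.smul_def]; exact hy g)
    exact Units.ext (Subtype.ext this)
  refine hψinf ?_
  have hfactor : Function.FactorsThrough ψ
      (fun g : AlgebraicClosure K ≃ₐ[K] AlgebraicClosure K => g (ε n)) := by
    intro g h hgh
    have := hker (g⁻¹ * h) (by
      change g⁻¹ (h (ε n)) = _
      rw [← show g (ε n) = h (ε n) from hgh]
      exact g.symm_apply_apply _)
    rw [map_mul, map_inv, inv_mul_eq_one] at this
    exact this
  have hrange : Set.range ψ ⊆ (Function.extend
      (fun g : AlgebraicClosure K ≃ₐ[K] AlgebraicClosure K => g (ε n)) ψ 1) ''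
      {u | u ^ p ^ n = 1} := by
    rintro _ ⟨g, rfl⟩
    refine ⟨g (ε n), ?_, hfactor.extend_apply 1 g⟩
    rw [Set.mem_ofPred_eq, ← map_pow, (hεprim n).pow_eq_one, map_one]
  refine (Set.Finite.image _ ?_).subset hrange
  refine (Polynomial.nthRootsFinset (p ^ n) (1 : AlgebraicClosure K)).finite_toSet.subset ?_
  intro u hu
  exact (Polynomial.mem_nthRootsFinset (pow_pos hp.pos n) _).2 hu
end

section
/- Fix a prime p and a finite extension K of ℚ_p with algebraic closure K̄ and C the completion of K̄. Fix a compatible system of primitive p^n-th roots of unity ε^{(n)} ∈ K̄ (ε^{(0)} = 1, ε^{(1)} ≠ 1, (ε^{(n+1)})^p = ε^{(n)}); let K_n = K(ε^{(n)}), K_∞ = ∪_n K_n, Γ_K = Gal(K_∞/K), and let K̂_∞ denote the closure of K_∞ in C. Then for each n ≥ 0 there exists a map pr_{K_n} : K̂_∞ → K_n which is continuous, K_n-linear, Γ_K-equivariant, restricts to the identity on K_n, and satisfies pr_{K_n}(x) = [K_m : K_n]^{-1}·Tr_{K_m/K_n}(x) for every m ≥ n and every x ∈ K_m. Moreover, for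 every x ∈ K̂_∞ one has x = lim_{n→∞} pr_{K_n}(x). -/
open Filter Topology

noncomputable section

namespace TateTrace

variable {K : Type*} [Field K] {C : Type*} [NormedField C]

/-- The field `K_n = K(ε⁽ⁿ⁾)`. -/
def Kn (ε : ℕ → AlgebraicClosure K) (n : ℕ) :
    IntermediateField K (AlgebraicClosure K) :=
  IntermediateField.adjoin K {ε n}

/-- `K̂_∞`, the closure in `C` of (the image of) `K_∞ = ⋃_n K_n`. -/
def Khat (ι : AlgebraicClosure K →+* C) (ε : ℕ → AlgebraicClosure K) : Set C :=
  closure (ι '' (⋃ n, (Kn ε n : Set (AlgebraicClosure K))))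

end TateTrace

namespace TateTrace

section Lemmas

open Polynomial IntermediateField

section Local

variable {p : ℕ} [Fact p.Prime] {Ω : Type*} [NormedField Ω] [NormedAlgebra ℚ_[p] Ω]

theorem norm_algEquiv [Algebra.IsAlgebraic ℚ_[p] Ω] (σ : Ω ≃ₐ[ℚ_[p]] Ω) (x : Ω) :
    ‖σ x‖ = ‖x‖ := by
  rw [NormedAlgebra.norm_eq_spectralNorm ℚ_[p] (σ x),
    NormedAlgebra.norm_eq_spectralNorm ℚ_[p] x, ← spectralNorm_eq_of_equiv]

theorem norm_eq_one_of_pow_eq_one {x : Ω} {N : ℕ} (hN : N ≠ 0) (hx : x ^ N = 1) : ‖x‖ = 1 := by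
  have h : ‖x‖ ^ N = 1 := by rw [← norm_pow, hx, norm_one]
  exact (pow_eq_one_iff_of_nonneg (norm_nonneg x) hN).1 h

theorem norm_one_sub_pow_le [IsUltrametricDist Ω] {x : Ω} (hx : ‖x‖ = 1) (i : ℕ) :
    ‖1 - x ^ i‖ ≤ ‖1 - x‖ := by
  rw [← mul_neg_geom_sum, norm_mul]
  refine mul_le_of_le_one_right (norm_nonneg _) ?_
  exact IsUltrametricDist.norm_sum_le_of_forall_le_of_nonneg zero_le_one
    fun j _ => by rw [norm_pow, hx, one_pow]

theorem norm_one_sub_eq_of_isPrimitiveRoot [IsUltrametricDist Ω] {x y : Ω} {N : ℕ} [NeZero N]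
    (hx : IsPrimitiveRoot x N) (hy : IsPrimitiveRoot y N) : ‖1 - x‖ = ‖1 - y‖ := by
  obtain ⟨i, -, rfl⟩ := hx.eq_pow_of_pow_eq_one hy.pow_eq_one
  refine le_antisymm ?_ (norm_one_sub_pow_le
    (norm_eq_one_of_pow_eq_one (NeZero.ne N) hx.pow_eq_one) i)
  obtain ⟨j, -, hj⟩ := hy.eq_pow_of_pow_eq_one hx.pow_eq_one
  have := norm_one_sub_pow_le (norm_eq_one_of_pow_eq_one (NeZero.ne N) hy.pow_eq_one) j
  rwa [hj] at this

theorem norm_natCast_prime : ‖(p : Ω)‖ = (p : ℝ)⁻¹ := by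
  rw [← map_natCast (algebraMap ℚ_[p] Ω), norm_algebraMap', Padic.norm_p]

theorem norm_sub_one_pow_totient [IsUltrametricDist Ω] {ζ : Ω} {k : ℕ}
    (hζ : IsPrimitiveRoot ζ (p ^ (k + 1))) :
    ‖ζ - 1‖ ^ (p ^ (k + 1)).totient = (p : ℝ)⁻¹ := by
  have : NeZero (p ^ (k + 1)) := ⟨pow_ne_zero _ (Fact.out : p.Prime).ne_zero⟩
  have h := eval_one_cyclotomic_prime_pow (R := Ω) (p := p) k
  rw [cyclotomic_eq_prod_X_sub_primitiveRoots hζ, eval_prod] at h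
  rw [← norm_natCast_prime (Ω := Ω), ← h, norm_prod, ← hζ.card_primitiveRoots]
  symm
  refine Finset.prod_eq_pow_card fun μ hμ => ?_
  rw [eval_sub, eval_X, eval_C, norm_sub_rev ζ,
    norm_one_sub_eq_of_isPrimitiveRoot (isPrimitiveRoot_of_mem_primitiveRoots hμ) hζ]

/-- Powers of a uniformizer of a totally ramified extension are orthogonal. -/
theorem norm_mul_pow_le_norm_sum [IsUltrametricDist Ω] {π : Ω} {N : ℕ}
    (hπ : ‖π‖ ^ N = (p : ℝ)⁻¹) (a : ℕ → ℚ_[p]) {i : ℕ} (hi : i < N) :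
    ‖a i‖ * ‖π‖ ^ i ≤ ‖∑ j ∈ Finset.range N, a j • π ^ j‖ := by
  have hp1 : (1 : ℝ) < p := by exact_mod_cast (Fact.out : p.Prime).one_lt
  have hp0 : (0 : ℝ) < p := zero_lt_one.trans hp1
  classical
  by_cases h0 : a i = 0
  · simp [h0]
  let s := (Finset.range N).filter fun j => a j ≠ 0
  have hs : s.Nonempty := ⟨i, by simp [s, hi, h0]⟩
  have hsum : ∑ j ∈ Finset.range N, a j • π ^ j = ∑ j ∈ s, a j • π ^ j := by
    refine (Finset.sum_subset (Finset.filter_subset _ _) fun j hj hj' => ?_).symm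
    have h : a j = 0 := by
      by_contra h
      exact hj' (Finset.mem_filter.2 ⟨hj, h⟩)
    rw [h, zero_smul]
  have hpow : ∀ j, a j ≠ 0 →
      ‖a j • π ^ j‖ ^ N = (p : ℝ) ^ (-((a j).valuation * N + j : ℤ)) := by
    intro j hj
    rw [norm_smul, norm_pow, mul_pow, ← pow_mul, mul_comm j N, pow_mul, hπ,
      Padic.norm_eq_zpow_neg_valuation hj, ← zpow_natCast, ← zpow_mul, inv_pow, ← zpow_natCast,
      ← zpow_neg, ← zpow_add₀ hp0.ne']
    congr 1
    ring
  have hne : (s : Set ℕ).Pairwise fun i j => ‖a i • π ^ i‖ ≠ ‖a j • π ^ j‖ := by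
    intro j hj k hk hjk heq
    simp only [s, Finset.coe_filter, Finset.mem_range, Set.mem_ofPred_eq] at hj hk
    have h := congrArg (· ^ N) heq
    simp only [hpow j hj.2, hpow k hk.2] at h
    have h' := zpow_right_injective₀ hp0 hp1.ne' h
    have h2 : (a j).valuation * N + j = (a k).valuation * N + (k : ℤ) := by linarith
    have h3 := congrArg (· % (N : ℤ)) h2
    simp only [Int.mul_add_emod_self_right] at h3
    apply hjk
    have h4 : ((j % N : ℕ) : ℤ) = ((k % N : ℕ) : ℤ) := by
      push_cast
      exact h3
    rw [Nat.mod_eq_of_lt hj.1, Nat.mod_eq_of_lt hk.1] at h4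
    exact_mod_cast h4
  rw [hsum, IsUltrametricDist.norm_sum_eq_sup'_of_pairwise_ne hs hne, ← norm_pow, ← norm_smul]
  exact Finset.le_sup' (fun j => ‖a j • π ^ j‖) (by simp [s, hi, h0])

theorem norm_coeff_le_of_sum [IsUltrametricDist Ω] {π : Ω} {N : ℕ}
    (hπ : ‖π‖ ^ N = (p : ℝ)⁻¹) (a : ℕ → ℚ_[p]) {i : ℕ} (hi : i < N) :
    ‖a i‖ ≤ p * ‖∑ j ∈ Finset.range N, a j • π ^ j‖ := by
  have hp1 : (1 : ℝ) < p := by exact_mod_cast (Fact.out : p.Prime).one_lt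
  have hp0 : (0 : ℝ) < p := zero_lt_one.trans hp1
  have hN : N ≠ 0 := by omega
  have hle : ‖π‖ ≤ 1 := by
    by_contra! h
    have := one_lt_pow₀ h hN
    rw [hπ] at this
    exact absurd this (inv_lt_one_of_one_lt₀ hp1).le.not_gt
  have h1 : (p : ℝ)⁻¹ ≤ ‖π‖ ^ i := hπ ▸ pow_le_pow_of_le_one (norm_nonneg _) hle hi.le
  have h2 := norm_mul_pow_le_norm_sum hπ a hi
  have h3 : ‖a i‖ * (p : ℝ)⁻¹ ≤ ‖∑ j ∈ Finset.range N, a j • π ^ j‖ :=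
    (mul_le_mul_of_nonneg_left h1 (norm_nonneg _)).trans h2
  rw [← div_eq_mul_inv, div_le_iff₀ hp0] at h3
  linarith

end Local

theorem exists_sum_of_mem_adjoin {k Ω : Type*} [Field k] [Field Ω] [Algebra k Ω] {y x : Ω}
    (hy : IsIntegral k y) (hx : x ∈ k⟮y⟯) {N : ℕ} (hN : (minpoly k y).natDegree ≤ N) :
    ∃ P : k[X], P.natDegree < N ∧ x = aeval y P := by
  rw [← IntermediateField.mem_toSubalgebra,
    IntermediateField.adjoin_simple_toSubalgebra_of_isAlgebraic hy.isAlgebraic,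
    Algebra.adjoin_singleton_eq_range_aeval] at hx
  obtain ⟨Q, rfl⟩ := hx
  refine ⟨Q %ₘ minpoly k y, ?_, ?_⟩
  · exact (natDegree_modByMonic_lt _ (minpoly.monic hy) (minpoly.ne_one k y)).trans_le hN
  · exact (aeval_modByMonic_eq_self_of_root (minpoly.aeval k y)).symm

section Local

variable {p : ℕ} [Fact p.Prime] {Ω : Type*} [NormedField Ω] [NormedAlgebra ℚ_[p] Ω]
  [IsUltrametricDist Ω] {ζ : Ω} {k : ℕ}

theorem isIntegral_of_isPrimitiveRoot {F Ω : Type*} [Field F] [Field Ω] [Algebra F Ω] {ζ : Ω} {N : ℕ}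
    [NeZero N] (hζ : IsPrimitiveRoot ζ N) : IsIntegral F ζ :=
  (hζ.isIntegral (Nat.pos_of_neZero N)).tower_top

theorem natDegree_minpoly_sub_one (hζ : IsPrimitiveRoot ζ (p ^ (k + 1))) :
    (minpoly ℚ_[p] (ζ - 1)).natDegree = (p ^ (k + 1)).totient := by
  have : NeZero (p ^ (k + 1)) := ⟨pow_ne_zero _ (Fact.out : p.Prime).ne_zero⟩
  have hint : IsIntegral ℚ_[p] (ζ - 1) := (isIntegral_of_isPrimitiveRoot hζ).sub isIntegral_one
  apply le_antisymm
  · have h : aeval (ζ - 1) ((cyclotomic (p ^ (k + 1)) ℚ_[p]).comp (X + C 1)) = 0 := by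
      rw [aeval_comp]
      simp only [map_add, aeval_X, map_one, sub_add_cancel]
      rw [aeval_def, eval₂_eq_eval_map, map_cyclotomic]
      exact hζ.isRoot_cyclotomic (Nat.pos_of_neZero _)
    have := natDegree_le_of_dvd (minpoly.dvd ℚ_[p] _ h)
      (((cyclotomic.monic _ _).comp_X_add_C 1).ne_zero)
    rwa [natDegree_comp, natDegree_X_add_C, mul_one, natDegree_cyclotomic] at this
  · by_contra! hlt
    set f := minpoly ℚ_[p] (ζ - 1) with hf
    have hN : ‖ζ - 1‖ ^ (p ^ (k + 1)).totient = (p : ℝ)⁻¹ := norm_sub_one_pow_totient hζ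
    have h := norm_coeff_le_of_sum hN (fun j => f.coeff j) hlt
    have h0 : ∑ j ∈ Finset.range (p ^ (k + 1)).totient, f.coeff j • (ζ - 1) ^ j = 0 := by
      rw [← aeval_eq_sum_range' hlt]
      exact minpoly.aeval _ _
    rw [h0, norm_zero, mul_zero, (minpoly.monic hint).coeff_natDegree, norm_one] at h
    linarith

theorem adjoin_sub_one (F : Type*) {Ω : Type*} [Field F] [Field Ω] [Algebra F Ω] (ζ : Ω) :
    F⟮ζ - 1⟯ = F⟮ζ⟯ := by
  apply le_antisymm <;> rw [adjoin_simple_le_iff]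
  · exact sub_mem (mem_adjoin_simple_self _ _) (one_mem _)
  · have := add_mem (mem_adjoin_simple_self F (ζ - 1)) (one_mem F⟮ζ - 1⟯)
    rwa [sub_add_cancel] at this

theorem finrank_adjoin_isPrimitiveRoot (hζ : IsPrimitiveRoot ζ (p ^ (k + 1))) :
    Module.finrank ℚ_[p] ℚ_[p]⟮ζ⟯ = (p ^ (k + 1)).totient := by
  have : NeZero (p ^ (k + 1)) := ⟨pow_ne_zero _ (Fact.out : p.Prime).ne_zero⟩
  rw [← adjoin_sub_one, IntermediateField.adjoin.finrank
    ((isIntegral_of_isPrimitiveRoot hζ).sub isIntegral_one), natDegree_minpoly_sub_one hζ]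

theorem norm_map_sub_one_pow_mul_le (T : Ω →ₗ[ℚ_[p]] Ω) (hT : ∀ i : ℕ, ‖T (ζ ^ i)‖ ≤ 1)
    (i j : ℕ) : ‖T ((ζ - 1) ^ i * ζ ^ j)‖ ≤ 1 := by
  induction i generalizing j with
  | zero => simpa using hT j
  | succ i ih =>
    have : (ζ - 1) ^ (i + 1) * ζ ^ j = (ζ - 1) ^ i * ζ ^ (j + 1) - (ζ - 1) ^ i * ζ ^ j := by ring
    rw [this, map_sub, sub_eq_add_neg]
    refine (IsUltrametricDist.norm_add_le_max _ _).trans ?_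
    rw [norm_neg]
    exact max_le (ih _) (ih _)

/-- A linear map that is bounded by one on the powers of a `p`-power root of unity `ζ` is bounded
on `ℚ_p(ζ)`, uniformly in `ζ`. -/
theorem norm_map_le_of_mem_adjoin (hζ : IsPrimitiveRoot ζ (p ^ (k + 1))) (T : Ω →ₗ[ℚ_[p]] Ω)
    (hT : ∀ i : ℕ, ‖T (ζ ^ i)‖ ≤ 1) {x : Ω} (hx : x ∈ ℚ_[p]⟮ζ⟯) : ‖T x‖ ≤ p * ‖x‖ := by
  have : NeZero (p ^ (k + 1)) := ⟨pow_ne_zero _ (Fact.out : p.Prime).ne_zero⟩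
  rw [← adjoin_sub_one] at hx
  obtain ⟨P, hP, rfl⟩ := exists_sum_of_mem_adjoin
    ((isIntegral_of_isPrimitiveRoot hζ).sub isIntegral_one) hx (natDegree_minpoly_sub_one hζ).le
  rw [aeval_eq_sum_range' hP, map_sum]
  refine IsUltrametricDist.norm_sum_le_of_forall_le_of_nonneg (by positivity) fun i hi => ?_
  rw [map_smul, norm_smul]
  have h1 := norm_map_sub_one_pow_mul_le T hT i 0
  rw [pow_zero, mul_one] at h1
  exact (mul_le_of_le_one_right (norm_nonneg _) h1).trans
    (norm_coeff_le_of_sum (norm_sub_one_pow_totient hζ) _ (Finset.mem_range.1 hi))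

end Local

section Fields

theorem map_minpoly_dvd_of_le {k Ω : Type*} [Field k] [Field Ω] [Algebra k Ω]
    {L L' : IntermediateField k Ω} (h : L ≤ L') (θ : Ω) :
    (minpoly L' θ).map (algebraMap L' Ω) ∣ (minpoly L θ).map (algebraMap L Ω) := by
  have h1 : aeval θ ((minpoly L θ).map (inclusion h).toRingHom) = 0 := by
    rw [aeval_def, eval₂_map]
    exact minpoly.aeval L θ
  have h2 := Polynomial.map_dvd (algebraMap L' Ω) (minpoly.dvd L' θ h1)
  rw [Polynomial.map_map] at h2
  exact h2

theorem adjoin_simple_le_adjoin_simple_of_pow {k Ω : Type*} [Field k] [Field Ω] [Algebra k Ω]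
    {ε : ℕ → Ω} {p : ℕ} (hεp : ∀ n, ε (n + 1) ^ p = ε n) : Monotone fun n => k⟮ε n⟯ := by
  refine monotone_nat_of_le_succ fun n => ?_
  rw [adjoin_simple_le_iff, ← hεp n]
  exact pow_mem (mem_adjoin_simple_self _ _) _

/-- The minimal polynomial of an integral element over an increasing sequence of fields is
eventually constant. -/
theorem exists_map_minpoly_eq {k Ω : Type*} [Field k] [Field Ω] [Algebra k Ω]
    {F : ℕ → IntermediateField k Ω} (hF : Monotone F) {θ : Ω} (hθ : IsIntegral k θ) :
    ∃ n₀ ≥ 1, ∀ m ≥ n₀, (minpoly (F m) θ).map (algebraMap (F m) Ω) =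
      (minpoly (F n₀) θ).map (algebraMap (F n₀) Ω) := by
  let d : ℕ → ℕ := fun n => (minpoly (F (n + 1)) θ).natDegree
  let i := Function.argmin d
  refine ⟨i + 1, by omega, fun m hm => ?_⟩
  have hi : ∀ n, IsIntegral (F n) θ := fun n => hθ.tower_top
  refine (eq_of_monic_of_dvd_of_natDegree_le ((minpoly.monic (hi m)).map _)
    ((minpoly.monic (hi _)).map _) (map_minpoly_dvd_of_le (hF hm) θ) ?_).symm
  rw [natDegree_map, natDegree_map]
  have := Function.argmin_le d (m - 1)
  simp only [d] at this
  rwa [show m - 1 + 1 = m by omega] at this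

theorem adjoin_le_adjoin_primitive {k K Ω : Type*} [Field k] [Field K] [Field Ω] [Algebra k K]
    [Algebra k Ω] [Algebra K Ω] [IsScalarTower k K Ω] {θ : K} (hθi : IsIntegral k θ)
    (hθ : k⟮θ⟯ = ⊤) {L : IntermediateField k Ω} {ζ : Ω} (hζ : ζ ∈ L) {x : Ω} (hx : x ∈ K⟮ζ⟯) :
    x ∈ L⟮algebraMap K Ω θ⟯ := by
  induction hx using IntermediateField.adjoin_induction with
  | mem x hx =>
    rw [Set.mem_singleton_iff.1 hx]
    exact IntermediateField.algebraMap_mem L⟮algebraMap K Ω θ⟯ ⟨ζ, hζ⟩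
  | algebraMap y =>
    have hy : y ∈ k⟮θ⟯ := hθ ▸ mem_top
    obtain ⟨P, -, rfl⟩ := exists_sum_of_mem_adjoin hθi hy le_rfl
    rw [← aeval_algebraMap_apply, ← aeval_map_algebraMap L]
    exact algebra_adjoin_le_adjoin L _ (aeval_mem_adjoin_singleton L _)
  | add x y _ _ hx hy => exact add_mem hx hy
  | inv x _ hx => exact inv_mem hx
  | mul x y _ _ hx hy => exact mul_mem hx hy

end Fields

section Local

variable {p : ℕ} [Fact p.Prime] {Ω : Type*} [NormedField Ω] [NormedAlgebra ℚ_[p] Ω]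
  [Algebra.IsAlgebraic ℚ_[p] Ω] [IsAlgClosed Ω]

/-- Coordinates with respect to the powers of `θ` are bounded, uniformly in the base field. -/
theorem exists_norm_coeff_le [IsUltrametricDist Ω] (θ : Ω) {f : Polynomial Ω} (hf : f.Separable) :
    ∃ M : ℝ, 0 ≤ M ∧ ∀ L : IntermediateField ℚ_[p] Ω, (minpoly L θ).map (algebraMap L Ω) = f →
      ∀ P : L[X], P.natDegree < f.natDegree → ∀ j, ‖(P.coeff j : Ω)‖ ≤ M * ‖aeval θ P‖ := by
  classical
  let s := f.roots.toFinset
  let b : Ω → Polynomial Ω := fun i => Lagrange.basis s id i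
  have hb : ∀ i ∈ s, ∀ j, ‖(b i).coeff j‖ ≤ ∑ i ∈ s, ∑ j ∈ (b i).support, ‖(b i).coeff j‖ := by
    intro i hi j
    have h0 : ∀ i ∈ s, 0 ≤ ∑ j ∈ (b i).support, ‖(b i).coeff j‖ :=
      fun i _ => Finset.sum_nonneg fun _ _ => norm_nonneg _
    refine le_trans ?_ (Finset.single_le_sum h0 hi)
    by_cases hj : j ∈ (b i).support
    · exact Finset.single_le_sum (f := fun j => ‖(b i).coeff j‖) (fun _ _ => norm_nonneg _) hj
    · rw [notMem_support_iff.1 hj, norm_zero]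
      exact h0 i hi
  refine ⟨∑ i ∈ s, ∑ j ∈ (b i).support, ‖(b i).coeff j‖,
    Finset.sum_nonneg fun _ _ => Finset.sum_nonneg fun _ _ => norm_nonneg _, ?_⟩
  intro L hL P hP j
  have hcard : s.card = f.natDegree := by
    rw [Multiset.toFinset_card_of_nodup (nodup_roots hf),
      (IsAlgClosed.splits f).natDegree_eq_card_roots]
  have hdeg : (P.map (algebraMap L Ω)).degree < s.card := by
    rw [hcard]
    refine (degree_le_natDegree).trans_lt ?_
    rw [natDegree_map]
    exact_mod_cast hP
  have hQ := Lagrange.eq_interpolate (v := id) (Set.injOn_id _) hdeg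
  rw [Lagrange.interpolate_apply] at hQ
  have hc : (P.coeff j : Ω) = ∑ i ∈ s, eval i (P.map (algebraMap L Ω)) * (b i).coeff j := by
    have := congrArg (fun Q => Q.coeff j) hQ
    simp only [coeff_map, finsetSum_coeff, coeff_C_mul, id] at this
    exact this
  rw [hc, mul_comm]
  refine IsUltrametricDist.norm_sum_le_of_forall_le_of_nonneg ?_ fun i hi => ?_
  · exact mul_nonneg (norm_nonneg _)
      (Finset.sum_nonneg fun _ _ => Finset.sum_nonneg fun _ _ => norm_nonneg _)
  rw [norm_mul]
  refine mul_le_mul (le_of_eq ?_) (hb i hi j) (norm_nonneg _) (norm_nonneg _)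
  have hθ : IsIntegral L θ := (Algebra.IsIntegral.isIntegral (R := ℚ_[p]) θ).tower_top
  have hroot : aeval i (minpoly L θ) = 0 := by
    have := (mem_roots'.1 (Multiset.mem_toFinset.1 hi)).2
    rwa [← hL, IsRoot, eval_map_algebraMap] at this
  have : Algebra.IsAlgebraic L Ω := Algebra.IsAlgebraic.tower_top (K := ℚ_[p]) L
  have : Normal L Ω := normal_iff.2 fun x => ⟨Algebra.IsIntegral.isIntegral x, IsAlgClosed.splits _⟩
  obtain ⟨σ, hσ⟩ := IsConjRoot.exists_algEquiv
    ((isConjRoot_iff_aeval_eq_zero hθ).2 hroot)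
  rw [eval_map_algebraMap, ← norm_algEquiv (σ.restrictScalars ℚ_[p]), AlgEquiv.restrictScalars_apply,
    ← hσ]
  exact congrArg _ (Polynomial.aeval_algHom_apply σ.toAlgHom i P).symm

end Local

section Cyclotomic

theorem norm_normalizedTrace_le_one_of_pow_eq_one {p : ℕ} [Fact p.Prime] {K Ω : Type*} [Field K]
    [NormedField Ω] [Algebra K Ω] [CharZero K] [Algebra.IsAlgebraic K Ω] [IsAlgClosed Ω]
    {ε : ℕ → Ω}
    (hε : ∀ n, IsPrimitiveRoot (ε n) (p ^ n)) (hεp : ∀ n, ε (n + 1) ^ p = ε n)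
    {n : ℕ} (hn : 1 ≤ n) (hnot : ∀ m ≥ n, ε (m + 1) ∉ K⟮ε m⟯) (j : ℕ) {ζ : Ω}
    (hζ : ζ ^ p ^ j = 1) : ‖(Algebra.normalizedTrace K⟮ε n⟯ Ω ζ : Ω)‖ ≤ 1 := by
  have hp := (Fact.out : p.Prime)
  have hne : ∀ n, NeZero (p ^ n) := fun n => ⟨pow_ne_zero _ hp.ne_zero⟩
  have hmem : ∀ j, ∀ x : Ω, x ^ p ^ j = 1 → x ∈ K⟮ε j⟯ := by
    intro j x hx
    obtain ⟨i, -, rfl⟩ := (hε j).eq_pow_of_pow_eq_one hx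
    exact pow_mem (mem_adjoin_simple_self _ _) _
  have hmono : Monotone fun n => K⟮ε n⟯ := adjoin_simple_le_adjoin_simple_of_pow hεp
  have hsmall : ζ ∈ K⟮ε n⟯ → ‖(Algebra.normalizedTrace K⟮ε n⟯ Ω ζ : Ω)‖ ≤ 1 := by
    intro h
    have := Algebra.normalizedTrace_algebraMap_apply_eq_self K⟮ε n⟯ Ω ⟨ζ, h⟩
    rw [show (algebraMap K⟮ε n⟯ Ω) ⟨ζ, h⟩ = ζ from rfl] at this
    rw [this]
    exact (norm_eq_one_of_pow_eq_one (hne j).out hζ).le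
  induction j with
  | zero => exact hsmall (hmono (Nat.zero_le n) (hmem 0 _ hζ))
  | succ j ih =>
    by_cases hj : ζ ^ p ^ j = 1
    · exact ih hj
    by_cases hjn : j + 1 ≤ n
    · exact hsmall (hmono hjn (hmem _ _ hζ))
    have hprim : IsPrimitiveRoot ζ (p ^ (j + 1)) :=
      orderOf_eq_prime_pow hj hζ ▸ IsPrimitiveRoot.orderOf ζ
    have hζj : ζ ∉ K⟮ε j⟯ := by
      intro h
      obtain ⟨i, -, hi⟩ := hprim.eq_pow_of_pow_eq_one (hε (j + 1)).pow_eq_one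
      exact hnot j (by omega) (hi ▸ pow_mem h i)
    have : Normal K⟮ε j⟯ Ω :=
      normal_iff.2 fun x => ⟨Algebra.IsIntegral.isIntegral x, IsAlgClosed.splits _⟩
    have : IsGalois K⟮ε j⟯ Ω := ⟨⟩
    obtain ⟨σ, hσ⟩ : ∃ σ : Ω ≃ₐ[K⟮ε j⟯] Ω, σ ζ ≠ ζ := by
      by_contra! h
      obtain ⟨y, hy⟩ := mem_bot.1 ((InfiniteGalois.mem_bot_iff_fixed ζ).2 h)
      exact hζj (hy ▸ y.2)
    have hle : K⟮ε n⟯ ≤ K⟮ε j⟯ := hmono (by omega : n ≤ j)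
    let τ : Ω ≃ₐ[K⟮ε n⟯] Ω :=
      AlgEquiv.ofRingEquiv (f := σ.toRingEquiv) fun r => σ.commutes ⟨r, hle r.2⟩
    have hζ0 : ζ ≠ 0 := hprim.ne_zero (hne _).out
    have hζp : σ (ζ ^ p) = ζ ^ p :=
      σ.commutes ⟨ζ ^ p, hmem j _ (by rw [← pow_mul, ← pow_succ', hζ])⟩
    have hω : (σ ζ / ζ) ^ p = 1 := by
      rw [div_pow, ← map_pow, hζp, div_self (pow_ne_zero _ hζ0)]
    have hωn : σ ζ / ζ ∈ K⟮ε n⟯ := hmono hn (hmem 1 _ (by rwa [pow_one]))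
    have h1 : Algebra.normalizedTrace K⟮ε n⟯ Ω (τ ζ) = Algebra.normalizedTrace K⟮ε n⟯ Ω ζ :=
      Algebra.normalizedTrace_map K⟮ε n⟯ Ω τ.toAlgHom ζ
    have h2 : τ ζ = (⟨σ ζ / ζ, hωn⟩ : K⟮ε n⟯) • ζ := (div_mul_cancel₀ (σ ζ) hζ0).symm
    have hω1 : (⟨σ ζ / ζ, hωn⟩ : K⟮ε n⟯) ≠ 1 := by
      intro h
      exact hσ ((div_eq_one_iff_eq hζ0).1 (congrArg Subtype.val h))
    rw [h2, map_smul, smul_eq_mul] at h1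
    have hT : Algebra.normalizedTrace K⟮ε n⟯ Ω ζ = 0 := by
      by_contra h
      exact hω1 ((mul_eq_right₀ h).1 h1)
    rw [hT]
    simp

variable {p : ℕ} [Fact p.Prime] {K Ω : Type*} [Field K] [Algebra ℚ_[p] K] [NormedField Ω]
  [NormedAlgebra ℚ_[p] Ω] [Algebra K Ω] [IsScalarTower ℚ_[p] K Ω] {ε : ℕ → Ω}

theorem isPrimitiveRoot_of_pow_eq {R : Type*} [CommRing R] {ε : ℕ → R}
    (hε0 : ε 0 = 1) (hε1 : ε 1 ≠ 1) (hεp : ∀ n, ε (n + 1) ^ p = ε n) (n : ℕ) :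
    IsPrimitiveRoot (ε n) (p ^ n) := by
  have h : ∀ n j, ε (n + j) ^ p ^ n = ε j := by
    intro n
    induction n with
    | zero => simp
    | succ n ih =>
      intro j
      rw [pow_succ', pow_mul, show n + 1 + j = n + j + 1 by omega, hεp, ih]
  cases n with
  | zero => simp [hε0]
  | succ n =>
    rw [← orderOf_eq_prime_pow (x := ε (n + 1)) (p := p) (n := n) (by rwa [h n 1])
      (by rw [← hε0]; exact h (n + 1) 0)]
    exact IsPrimitiveRoot.orderOf _

theorem notMem_adjoin_of_map_minpoly_eq [IsUltrametricDist Ω]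
    (hε : ∀ n, IsPrimitiveRoot (ε n) (p ^ n)) (hεp : ∀ n, ε (n + 1) ^ p = ε n)
    {θ : K} (hθi : IsIntegral ℚ_[p] θ) (hθ : ℚ_[p]⟮θ⟯ = ⊤) {m : ℕ} (hm : 1 ≤ m)
    (h : (minpoly ℚ_[p]⟮ε m⟯ (algebraMap K Ω θ)).map (algebraMap _ Ω) =
      (minpoly ℚ_[p]⟮ε (m + 1)⟯ (algebraMap K Ω θ)).map (algebraMap _ Ω)) :
    ε (m + 1) ∉ K⟮ε m⟯ := by
  intro hmem
  have hle : ℚ_[p]⟮ε m⟯ ≤ ℚ_[p]⟮ε (m + 1)⟯ :=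
    adjoin_simple_le_adjoin_simple_of_pow hεp m.le_succ
  have hθ' : IsIntegral ℚ_[p] (algebraMap K Ω θ) := hθi.algebraMap
  obtain ⟨P, hP, hPε⟩ := exists_sum_of_mem_adjoin (hθ'.tower_top (A := ℚ_[p]⟮ε m⟯))
    (adjoin_le_adjoin_primitive hθi hθ (mem_adjoin_simple_self ℚ_[p] (ε m)) hmem) le_rfl
  let Q := P.map (inclusion hle).toRingHom - C ⟨ε (m + 1), mem_adjoin_simple_self _ _⟩
  have hQ0 : aeval (algebraMap K Ω θ) Q = 0 := by
    have h1 : aeval (algebraMap K Ω θ) (P.map (inclusion hle).toRingHom) = ε (m + 1) := by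
      refine Eq.trans ?_ hPε.symm
      rw [aeval_def, eval₂_map]
      rfl
    rw [map_sub, h1, aeval_C]
    exact sub_self _
  have hdeg := congrArg natDegree h
  rw [natDegree_map, natDegree_map] at hdeg
  have hQ : Q = 0 := by
    refine eq_zero_of_dvd_of_natDegree_lt (minpoly.dvd _ _ hQ0) ?_
    rw [← hdeg, natDegree_sub_C]
    exact natDegree_map_le.trans_lt hP
  have hcoeff := congrArg (fun Q => ((Q.coeff 0 : ℚ_[p]⟮ε (m + 1)⟯) : Ω)) hQ
  have hεm : ε (m + 1) ∈ ℚ_[p]⟮ε m⟯ := by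
    simp only [Q, coeff_sub, coeff_map, coeff_C_zero, coeff_zero] at hcoeff
    have : ((P.coeff 0 : ℚ_[p]⟮ε m⟯) : Ω) = ε (m + 1) := sub_eq_zero.1 hcoeff
    exact this ▸ (P.coeff 0).2
  have heq : ℚ_[p]⟮ε (m + 1)⟯ = ℚ_[p]⟮ε m⟯ := le_antisymm (by rwa [adjoin_simple_le_iff]) hle
  obtain ⟨m, rfl⟩ : ∃ k, m = k + 1 := ⟨m - 1, by omega⟩
  have hfr := finrank_adjoin_isPrimitiveRoot (hε (m + 1 + 1))
  have hp := (Fact.out : p.Prime)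
  rw [heq, finrank_adjoin_isPrimitiveRoot (hε (m + 1)), Nat.totient_prime_pow_succ hp,
    Nat.totient_prime_pow_succ hp] at hfr
  have h2 := Nat.eq_of_mul_eq_mul_right (Nat.sub_pos_of_lt hp.one_lt) hfr
  exact absurd (Nat.pow_right_injective hp.two_le h2) (by omega)

variable [CharZero K] [Algebra.IsAlgebraic K Ω] [IsAlgClosed Ω]

/-- The normalized traces to `K(ε n)` are uniformly bounded for large `n`. -/
theorem exists_norm_normalizedTrace_le [IsUltrametricDist Ω] [FiniteDimensional ℚ_[p] K]
    (hε : ∀ n, IsPrimitiveRoot (ε n) (p ^ n)) (hεp : ∀ n, ε (n + 1) ^ p = ε n) :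
    ∃ n₀ : ℕ, ∃ M : ℝ, 0 ≤ M ∧ ∀ n ≥ n₀, ∀ m ≥ n, ∀ x ∈ K⟮ε m⟯,
      ‖(Algebra.normalizedTrace K⟮ε n⟯ Ω x : Ω)‖ ≤ M * ‖x‖ := by
  have : Algebra.IsAlgebraic ℚ_[p] Ω := Algebra.IsAlgebraic.trans ℚ_[p] K Ω
  obtain ⟨θ, hθ⟩ := Field.exists_primitive_element ℚ_[p] K
  have hθi : IsIntegral ℚ_[p] θ := Algebra.IsIntegral.isIntegral θ
  set θ' := algebraMap K Ω θ with hθ'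
  have hmonoF : Monotone fun n => ℚ_[p]⟮ε n⟯ := adjoin_simple_le_adjoin_simple_of_pow hεp
  have hmono : Monotone fun n => K⟮ε n⟯ := adjoin_simple_le_adjoin_simple_of_pow hεp
  obtain ⟨n₀, hn₀, hmin⟩ := exists_map_minpoly_eq hmonoF (hθi.algebraMap (B := Ω))
  set f := (minpoly ℚ_[p]⟮ε n₀⟯ θ').map (algebraMap _ Ω) with hf
  have hnot : ∀ m ≥ n₀, ε (m + 1) ∉ K⟮ε m⟯ := fun m hm =>
    notMem_adjoin_of_map_minpoly_eq hε hεp hθi hθ (hn₀.trans hm)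
      ((hmin m hm).trans (hmin (m + 1) (by omega)).symm)
  have hsep : f.Separable :=
    Separable.map (Algebra.IsSeparable.isSeparable ℚ_[p]⟮ε n₀⟯ θ')
  obtain ⟨M, hM0, hM⟩ := exists_norm_coeff_le (p := p) θ' hsep
  refine ⟨n₀, max 1 ‖θ'‖ ^ f.natDegree * (p * M), by positivity, fun n hn m hm x hx => ?_⟩
  have hm0 : n₀ ≤ m := hn.trans hm
  obtain ⟨P, hP, rfl⟩ := exists_sum_of_mem_adjoin
    ((hθi.algebraMap (B := Ω)).tower_top (A := ℚ_[p]⟮ε m⟯))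
    (adjoin_le_adjoin_primitive hθi hθ (mem_adjoin_simple_self ℚ_[p] (ε m)) hx) le_rfl
  have hPf : P.natDegree < f.natDegree := by
    rwa [← hmin m hm0, natDegree_map]
  let T : Ω →ₗ[K] Ω :=
    (Algebra.linearMap K⟮ε n⟯ Ω ∘ₗ Algebra.normalizedTrace K⟮ε n⟯ Ω).restrictScalars K
  have hT : ∀ b ∈ ℚ_[p]⟮ε m⟯, ‖T b‖ ≤ p * ‖b‖ := by
    obtain ⟨k, rfl⟩ : ∃ k, m = k + 1 := ⟨m - 1, by omega⟩
    intro b hb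
    refine norm_map_le_of_mem_adjoin (hε (k + 1)) (T.restrictScalars ℚ_[p]) (fun i => ?_) hb
    exact norm_normalizedTrace_le_one_of_pow_eq_one hε hεp (hn₀.trans hn)
      (fun m hm => hnot m (hn.trans hm)) (k + 1)
      (by rw [pow_right_comm, (hε (k + 1)).pow_eq_one, one_pow])
  change ‖T (aeval θ' P)‖ ≤ _
  have hcoef := hM _ (hmin m hm0) P hPf
  have hr : 0 ≤ ‖aeval θ' P‖ := norm_nonneg _
  generalize ‖aeval θ' P‖ = r at hcoef hr ⊢
  rw [aeval_eq_sum_range' hPf, map_sum]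
  refine IsUltrametricDist.norm_sum_le_of_forall_le_of_nonneg (by positivity) fun i hi => ?_
  have h1 : P.coeff i • θ' ^ i = θ ^ i • (P.coeff i : Ω) := by
    rw [Algebra.smul_def (θ ^ i), map_pow, mul_comm]
    rfl
  rw [h1, map_smul, Algebra.smul_def, norm_mul, map_pow, norm_pow, mul_assoc, mul_assoc]
  refine mul_le_mul ?_ ?_ (norm_nonneg _) (by positivity)
  · exact (pow_le_pow_left₀ (norm_nonneg _) (le_max_right _ _) i).trans
      (pow_le_pow_right₀ (le_max_left _ _) (Finset.mem_range.1 hi).le)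
  · exact (hT _ (P.coeff i).2).trans (mul_le_mul_of_nonneg_left (hcoef i) (by positivity))

end Cyclotomic

section Algebraic

variable {K Ω : Type*} [Field K] [Field Ω] [Algebra K Ω] [CharZero K] [Algebra.IsAlgebraic K Ω]

theorem coe_normalizedTrace_algEquiv {L : IntermediateField K Ω}
    (hL : ∀ (σ : Ω ≃ₐ[K] Ω), ∀ x ∈ L, σ x ∈ L) (σ : Ω ≃ₐ[K] Ω) (x : Ω) :
    (Algebra.normalizedTrace L Ω (σ x) : Ω) = σ (Algebra.normalizedTrace L Ω x) := by
  let τ : L ≃+* L :=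
    { toFun := fun x => ⟨σ x, hL σ x x.2⟩
      invFun := fun x => ⟨σ.symm x, hL σ.symm x x.2⟩
      left_inv := fun x => Subtype.ext (σ.symm_apply_apply x)
      right_inv := fun x => Subtype.ext (σ.apply_symm_apply x)
      map_mul' := fun x y => Subtype.ext (map_mul σ (x : Ω) y)
      map_add' := fun x y => Subtype.ext (map_add σ (x : Ω) y) }
  have hmin : (minpoly L x).map (τ : L →+* L) = minpoly L (σ x) :=
    minpoly.map_eq_of_equiv_equiv (f := τ) (g := σ.toRingEquiv) rfl x
  rw [Algebra.normalizedTrace_minpoly, Algebra.normalizedTrace_minpoly, ← hmin, natDegree_map,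
    nextCoeff_map (RingHom.injective _), smul_eq_mul, smul_eq_mul]
  push_cast
  rw [map_mul, map_inv₀, map_neg, map_natCast]
  rfl

theorem normalizedTrace_eq_of_mem_extendScalars {L L' : IntermediateField K Ω}
    [FiniteDimensional K L'] (hle : L ≤ L') {x : Ω} (hx : x ∈ extendScalars hle) :
    (Algebra.normalizedTrace L Ω x : Ω) =
      (Module.finrank L (extendScalars hle) : Ω)⁻¹ *
        algebraMap L Ω (Algebra.trace L (extendScalars hle) ⟨x, hx⟩) := by
  have : FiniteDimensional K (extendScalars hle) := ‹FiniteDimensional K L'›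
  have : FiniteDimensional L (extendScalars hle) := Module.Finite.of_restrictScalars_finite K _ _
  have h := Algebra.normalizedTrace_intermediateField L Ω (E := extendScalars hle) ⟨x, hx⟩
  have h' : Algebra.normalizedTrace L Ω x = _ :=
    h.trans (Algebra.normalizedTrace_eq_of_finiteDimensional_apply L _)
  rw [h', smul_eq_mul]
  push_cast
  rfl

theorem normalizedTrace_algebraMap_normalizedTrace (F E : Type*) {N : Type*} [Field F] [Field E]
    [Field N] [CharZero F] [CharZero E] [Algebra F E] [Algebra E N] [Algebra F N]
    [IsScalarTower F E N] [Algebra.IsIntegral F N] [Algebra.IsIntegral E N] (x : N) :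
    Algebra.normalizedTrace F N (algebraMap E N (Algebra.normalizedTrace E N x)) =
      Algebra.normalizedTrace F N x := by
  have : Algebra.IsIntegral F E := Algebra.IsIntegral.tower_bot (T := N)
  rw [Algebra.normalizedTrace_algebraMap_apply, Algebra.normalizedTrace_trans_apply]

theorem normalizedTrace_normalizedTrace {L L' : IntermediateField K Ω} (hle : L ≤ L') (x : Ω) :
    Algebra.normalizedTrace L Ω (Algebra.normalizedTrace L' Ω x : Ω) =
      Algebra.normalizedTrace L Ω x := by
  let _ : Algebra L L' := (inclusion hle).toRingHom.toAlgebra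
  have : IsScalarTower L L' Ω := IsScalarTower.of_algebraMap_eq fun _ => rfl
  exact normalizedTrace_algebraMap_normalizedTrace L L' x

end Algebraic

section Bounds

variable {p : ℕ} [Fact p.Prime] {K Ω : Type*} [Field K] [Algebra ℚ_[p] K]
  [FiniteDimensional ℚ_[p] K]

theorem exists_norm_map_le_of_finiteDimensional [NormedField Ω] [NormedAlgebra ℚ_[p] Ω]
    (V : Submodule ℚ_[p] Ω) [FiniteDimensional ℚ_[p] V] (T : Ω →ₗ[ℚ_[p]] Ω) :
    ∃ M : ℝ, 0 ≤ M ∧ ∀ x ∈ V, ‖T x‖ ≤ M * ‖x‖ :=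
  ⟨_, norm_nonneg (T ∘ₗ V.subtype).toContinuousLinearMap, fun x hx =>
    (T ∘ₗ V.subtype).toContinuousLinearMap.le_opNorm ⟨x, hx⟩⟩

theorem finiteDimensional_adjoin_padic [Field Ω] [Algebra ℚ_[p] Ω] [Algebra K Ω]
    [IsScalarTower ℚ_[p] K Ω] [Algebra.IsAlgebraic K Ω] (x : Ω) :
    FiniteDimensional ℚ_[p] K⟮x⟯ := by
  have := adjoin.finiteDimensional (Algebra.IsIntegral.isIntegral (R := K) x)
  exact Module.Finite.trans K _

theorem exists_norm_normalizedTrace_le_of_normed [CharZero K] [NormedField Ω] [NormedAlgebra ℚ_[p] Ω]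
    [IsUltrametricDist Ω] [Algebra K Ω] [IsScalarTower ℚ_[p] K Ω] [Algebra.IsAlgebraic K Ω]
    [IsAlgClosed Ω] {ε : ℕ → Ω} (hε : ∀ n, IsPrimitiveRoot (ε n) (p ^ n))
    (hεp : ∀ n, ε (n + 1) ^ p = ε n) :
    ∃ M : ℕ → ℝ, (∀ n, 0 ≤ M n) ∧ (∃ B, ∀ᶠ n in atTop, M n = B) ∧ ∀ n m, ∀ x ∈ K⟮ε m⟯,
      ‖(Algebra.normalizedTrace K⟮ε n⟯ Ω x : Ω)‖ ≤ M n * ‖x‖ := by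
  have hmono : Monotone fun n => K⟮ε n⟯ := adjoin_simple_le_adjoin_simple_of_pow hεp
  obtain ⟨n₀, B, hB0, hB⟩ := exists_norm_normalizedTrace_le (K := K) hε hεp
  have hlow : ∀ n, ∃ M : ℝ, 0 ≤ M ∧ (n₀ ≤ n → M = B) ∧ ∀ m, ∀ x ∈ K⟮ε m⟯,
      ‖(Algebra.normalizedTrace K⟮ε n⟯ Ω x : Ω)‖ ≤ M * ‖x‖ := by
    intro n
    by_cases hn : n₀ ≤ n
    · exact ⟨B, hB0, fun _ => rfl, fun m x hx =>
        hB n hn (max m n) (le_max_right _ _) x (hmono (le_max_left _ _) hx)⟩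
    have hle : K⟮ε n⟯ ≤ K⟮ε n₀⟯ := hmono (le_of_not_ge hn)
    have : FiniteDimensional ℚ_[p] (K⟮ε n₀⟯.toSubmodule.restrictScalars ℚ_[p]) :=
      finiteDimensional_adjoin_padic (ε n₀)
    let T : Ω →ₗ[K] Ω :=
      (Algebra.linearMap K⟮ε n⟯ Ω ∘ₗ Algebra.normalizedTrace K⟮ε n⟯ Ω).restrictScalars K
    obtain ⟨M, hM0, hM⟩ := exists_norm_map_le_of_finiteDimensional
      (K⟮ε n₀⟯.toSubmodule.restrictScalars ℚ_[p]) (T.restrictScalars ℚ_[p])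
    refine ⟨M * B, by positivity, fun h => absurd h hn, fun m x hx => ?_⟩
    rw [← normalizedTrace_normalizedTrace hle, mul_assoc]
    exact (hM _ (Algebra.normalizedTrace K⟮ε n₀⟯ Ω x).2).trans (mul_le_mul_of_nonneg_left
      (hB n₀ le_rfl (max m n₀) (le_max_right _ _) x (hmono (le_max_left _ _) hx)) hM0)
  choose M hM0 hMB hM using hlow
  exact ⟨M, hM0, ⟨B, (eventually_ge_atTop n₀).mono hMB⟩, hM⟩

theorem exists_norm_normalizedTrace_le_of_ringHom [CharZero K] [Field Ω] [Algebra ℚ_[p] Ω] [Algebra K Ω]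
    [IsScalarTower ℚ_[p] K Ω] [Algebra.IsAlgebraic K Ω] [IsAlgClosed Ω] {C : Type*}
    [NormedField C] [IsUltrametricDist C] (ι : Ω →+* C)
    (hι : ∀ a : ℚ_[p], ‖ι (algebraMap ℚ_[p] Ω a)‖ = ‖a‖)
    {ε : ℕ → Ω} (hε : ∀ n, IsPrimitiveRoot (ε n) (p ^ n)) (hεp : ∀ n, ε (n + 1) ^ p = ε n) :
    ∃ M : ℕ → ℝ, (∀ n, 0 ≤ M n) ∧ (∃ B, ∀ᶠ n in atTop, M n = B) ∧ ∀ n m, ∀ x ∈ K⟮ε m⟯,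
      ‖ι (Algebra.normalizedTrace K⟮ε n⟯ Ω x : Ω)‖ ≤ M n * ‖ι x‖ := by
  let _ : NormedField Ω := NormedField.induced Ω C ι ι.injective
  let _ : NormedAlgebra ℚ_[p] Ω :=
    { (inferInstance : Algebra ℚ_[p] Ω) with
      norm_smul_le := fun a x => by
        rw [Algebra.smul_def, norm_mul]
        exact (congrArg (· * ‖x‖) (hι a)).le }
  have : IsUltrametricDist Ω := IsUltrametricDist.isUltrametricDist_of_forall_norm_add_le_max_norm
    fun x y => by
      change ‖ι (x + y)‖ ≤ max ‖ι x‖ ‖ι y‖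
      rw [map_add]
      exact IsUltrametricDist.norm_add_le_max _ _
  exact exists_norm_normalizedTrace_le_of_normed hε hεp

end Bounds

section Extension

theorem exists_continuousOn_closure_extension {V : Type*} [NormedAddCommGroup V] [CompleteSpace V]
    (A : AddSubgroup V) (f : V → V) (hadd : ∀ x ∈ A, ∀ y ∈ A, f (x + y) = f x + f y)
    {M : ℝ} (hM : 0 ≤ M) (hf : ∀ x ∈ A, ‖f x‖ ≤ M * ‖x‖) :
    ∃ g : V → V, ContinuousOn g (closure A) ∧ Set.EqOn g f A ∧
      (∀ x ∈ closure (A : Set V), ∀ y ∈ closure (A : Set V), g (x + y) = g x + g y) ∧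
      ∀ x ∈ closure (A : Set V), ‖g x‖ ≤ M * ‖x‖ := by
  have hlip : LipschitzOnWith ⟨M, hM⟩ f A := by
    refine LipschitzOnWith.of_dist_le_mul fun x hx y hy => ?_
    have h := hadd (x - y) (sub_mem hx hy) y hy
    rw [sub_add_cancel] at h
    rw [dist_eq_norm, dist_eq_norm, h, add_sub_cancel_right]
    exact hf _ (sub_mem hx hy)
  have hlim : ∀ x ∈ closure (A : Set V), ∃ y, Tendsto f (𝓝[A] x) (𝓝 y) := by
    intro x hx
    have : (𝓝[(A : Set V)] x).NeBot := mem_closure_iff_nhdsWithin_neBot.1 hx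
    have : (𝓝 x ⊓ 𝓟 (A : Set V)).NeBot := this
    exact cauchy_map_iff_exists_tendsto.1 ((cauchy_nhds.mono inf_le_left).map_of_le
      hlip.uniformContinuousOn inf_le_right)
  let g := extendFrom (A : Set V) f
  have hg : ContinuousOn g (closure A) := continuousOn_extendFrom le_rfl hlim
  have heq : Set.EqOn g f A := fun x hx =>
    extendFrom_eq (subset_closure hx) (hlip.continuousOn x hx)
  have hsum : ∀ x ∈ closure (A : Set V), ∀ y ∈ closure (A : Set V), x + y ∈ closure (A : Set V) :=
    fun x hx y hy => add_mem (S := AddSubgroup V) (s := A.topologicalClosure) hx hy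
  have hAc : (A : Set V) ⊆ closure A := subset_closure
  have hadd1 : ∀ y ∈ A, ∀ x ∈ closure (A : Set V), g (x + y) = g x + g y := by
    intro y hy
    refine Set.EqOn.of_subset_closure (s := (A : Set V)) (fun x hx => ?_) ?_ ?_ hAc le_rfl
    · rw [heq hx, heq hy, heq (add_mem hx hy), hadd x hx y hy]
    · exact hg.comp (by fun_prop) fun x hx => hsum x hx y (hAc hy)
    · exact hg.add continuousOn_const
  refine ⟨g, hg, heq, fun x hx => ?_, fun x hx => ?_⟩
  · refine Set.EqOn.of_subset_closure (s := (A : Set V)) (fun y hy => hadd1 y hy x hx) ?_ ?_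
      hAc le_rfl
    · exact hg.comp (by fun_prop) fun y hy => hsum x hx y hy
    · exact continuousOn_const.add hg
  · have : (𝓝[(A : Set V)] x).NeBot := mem_closure_iff_nhdsWithin_neBot.1 hx
    refine le_of_tendsto_of_tendsto ((hg x hx).mono_left (nhdsWithin_mono x hAc)).norm
      ((continuous_norm.tendsto x).const_mul M |>.mono_left inf_le_left) ?_
    filter_upwards [self_mem_nhdsWithin] with y hy
    rw [heq hy]
    exact hf y hy

end Extension

section Main

variable {p : ℕ} [Fact p.Prime] {K Ω C : Type*} [Field K] [Field Ω] [Algebra K Ω]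

theorem map_mem_adjoin_of_isPrimitiveRoot {n : ℕ} [NeZero n] {ζ : Ω} (hζ : IsPrimitiveRoot ζ n)
    (σ : Ω ≃ₐ[K] Ω) {x : Ω} (hx : x ∈ K⟮ζ⟯) : σ x ∈ K⟮ζ⟯ := by
  have hle : K⟮ζ⟯ ≤ K⟮ζ⟯.comap σ.toAlgHom := by
    rw [adjoin_simple_le_iff]
    obtain ⟨i, -, hi⟩ := hζ.eq_pow_of_pow_eq_one (ξ := σ ζ)
      (by rw [← map_pow, hζ.pow_eq_one, map_one])
    change σ ζ ∈ K⟮ζ⟯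
    rw [← hi]
    exact pow_mem (mem_adjoin_simple_self K ζ) i
  exact hle hx

variable [Algebra ℚ_[p] K] [FiniteDimensional ℚ_[p] K] [Algebra ℚ_[p] Ω] [IsScalarTower ℚ_[p] K Ω]
  [Algebra.IsAlgebraic K Ω]

theorem isClosed_image_adjoin [NormedField C] (ι : Ω →+* C)
    (hι : ∀ a : ℚ_[p], ‖ι (algebraMap ℚ_[p] Ω a)‖ = ‖a‖) (x : Ω) :
    IsClosed (ι '' (K⟮x⟯ : Set Ω)) := by
  let _ : Algebra ℚ_[p] C := (ι.comp (algebraMap ℚ_[p] Ω)).toAlgebra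
  let _ : NormedAlgebra ℚ_[p] C :=
    { (inferInstance : Algebra ℚ_[p] C) with
      norm_smul_le := fun a y => by
        rw [Algebra.smul_def, norm_mul]
        exact (congrArg (· * ‖y‖) (hι a)).le }
  let ι' : Ω →ₐ[ℚ_[p]] C := { ι with commutes' := fun _ => rfl }
  have : FiniteDimensional ℚ_[p] (K⟮x⟯.toSubmodule.restrictScalars ℚ_[p]) :=
    finiteDimensional_adjoin_padic x
  exact Submodule.closed_of_finiteDimensional
    ((K⟮x⟯.toSubmodule.restrictScalars ℚ_[p]).map ι'.toLinearMap)

/-- The image under `ι` of the union of an increasing sequence of intermediate fields. -/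
def imageUnion [NormedField C] (ι : Ω →+* C) {F : ℕ → IntermediateField K Ω} (hF : Monotone F) :
    AddSubgroup C where
  carrier := ι '' ⋃ n, (F n : Set Ω)
  zero_mem' := ⟨0, Set.mem_iUnion.2 ⟨0, zero_mem _⟩, map_zero ι⟩
  add_mem' := by
    rintro _ _ ⟨x, hx, rfl⟩ ⟨y, hy, rfl⟩
    obtain ⟨n, hn⟩ := Set.mem_iUnion.1 hx
    obtain ⟨m, hm⟩ := Set.mem_iUnion.1 hy
    exact ⟨x + y, Set.mem_iUnion.2 ⟨max n m, add_mem (hF (le_max_left n m) hn)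
      (hF (le_max_right n m) hm)⟩, map_add ι x y⟩
  neg_mem' := by
    rintro _ ⟨x, hx, rfl⟩
    obtain ⟨n, hn⟩ := Set.mem_iUnion.1 hx
    exact ⟨-x, Set.mem_iUnion.2 ⟨n, neg_mem hn⟩, map_neg ι x⟩

theorem exists_continuous_normalizedTrace [CharZero K] [IsAlgClosed Ω]
    [NormedField C] [CompleteSpace C] [IsUltrametricDist C] (ι : Ω →+* C)
    (hι : ∀ a : ℚ_[p], ‖ι (algebraMap ℚ_[p] Ω a)‖ = ‖a‖) {ε : ℕ → Ω}
    (hε : ∀ n, IsPrimitiveRoot (ε n) (p ^ n)) (hεp : ∀ n, ε (n + 1) ^ p = ε n) :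
    ∃ pr : ℕ → C → C,
      (∀ n, ContinuousOn (pr n) (closure (ι '' ⋃ n, (K⟮ε n⟯ : Set Ω)))) ∧
      (∀ n m, ∀ x ∈ K⟮ε m⟯, pr n (ι x) = ι (Algebra.normalizedTrace K⟮ε n⟯ Ω x : Ω)) ∧
      (∀ n, ∀ x ∈ closure (ι '' ⋃ n, (K⟮ε n⟯ : Set Ω)),
        ∀ y ∈ closure (ι '' ⋃ n, (K⟮ε n⟯ : Set Ω)), pr n (x + y) = pr n x + pr n y) ∧
      (∀ x ∈ closure (ι '' ⋃ n, (K⟮ε n⟯ : Set Ω)), Tendsto (fun n => pr n x) atTop (𝓝 x)) := by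
  have hmono : Monotone fun n => K⟮ε n⟯ := adjoin_simple_le_adjoin_simple_of_pow hεp
  obtain ⟨M, hM0, ⟨B, hB⟩, hM⟩ := exists_norm_normalizedTrace_le_of_ringHom (K := K) ι hι hε hεp
  let A := imageUnion ι hmono
  let f : ℕ → C → C := fun n =>
    Function.extend ι (fun x => ι (Algebra.normalizedTrace K⟮ε n⟯ Ω x : Ω)) 0
  have hf : ∀ n x, f n (ι x) = ι (Algebra.normalizedTrace K⟮ε n⟯ Ω x : Ω) := fun n x =>
    ι.injective.extend_apply _ _ x
  have hext : ∀ n, ∃ g : C → C, ContinuousOn g (closure A) ∧ Set.EqOn g (f n) A ∧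
      (∀ x ∈ closure (A : Set C), ∀ y ∈ closure (A : Set C), g (x + y) = g x + g y) ∧
      ∀ x ∈ closure (A : Set C), ‖g x‖ ≤ M n * ‖x‖ := by
    intro n
    refine exists_continuousOn_closure_extension A (f n) ?_ (hM0 n) ?_
    · rintro _ ⟨x, -, rfl⟩ _ ⟨y, -, rfl⟩
      rw [← map_add, hf, hf, hf, map_add]
      push_cast
      exact map_add ι _ _
    · rintro _ ⟨x, hx, rfl⟩
      obtain ⟨m, hm⟩ := Set.mem_iUnion.1 hx
      rw [hf]
      exact hM n m x hm
  choose pr hpr hprA hadd hbound using hext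
  have hval : ∀ n m, ∀ x ∈ K⟮ε m⟯, pr n (ι x) = ι (Algebra.normalizedTrace K⟮ε n⟯ Ω x : Ω) :=
    fun n m x hx => (hprA n ⟨x, Set.mem_iUnion.2 ⟨m, hx⟩, rfl⟩).trans (hf n x)
  refine ⟨pr, hpr, hval, hadd, fun x hx => ?_⟩
  have hB0 : 0 ≤ B := by
    obtain ⟨n, hn⟩ := hB.exists
    exact hn ▸ hM0 n
  rw [Metric.tendsto_atTop']
  intro δ hδ
  obtain ⟨_, ⟨a, ha, rfl⟩, hxa⟩ := Metric.mem_closure_iff.1 hx (δ / (B + 1)) (by positivity)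
  obtain ⟨m, hm⟩ := Set.mem_iUnion.1 ha
  obtain ⟨N, hN⟩ := eventually_atTop.1 hB
  refine ⟨max m N, fun n hn => ?_⟩
  have haA : ι a ∈ closure (A : Set C) := subset_closure ⟨a, ha, rfl⟩
  have hxaA : x - ι a ∈ closure (A : Set C) :=
    A.topologicalClosure.sub_mem hx haA
  have hself : pr n (ι a) = ι a := by
    rw [hval n m a hm]
    exact congrArg (fun z : K⟮ε n⟯ => ι z) (Algebra.normalizedTrace_algebraMap_apply_eq_self
      K⟮ε n⟯ Ω ⟨a, hmono ((le_max_left m N).trans hn.le) hm⟩)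
  have hsplit : pr n x - x = pr n (x - ι a) - (x - ι a) := by
    have h := hadd n _ hxaA _ haA
    rw [sub_add_cancel, hself] at h
    rw [h]
    ring
  rw [dist_eq_norm] at hxa ⊢
  calc ‖pr n x - x‖ ≤ ‖pr n (x - ι a)‖ + ‖x - ι a‖ := hsplit ▸ norm_sub_le _ _
    _ ≤ B * ‖x - ι a‖ + ‖x - ι a‖ := by
      gcongr
      exact hN n ((le_max_right m N).trans hn.le) ▸ hbound n _ hxaA
    _ = (B + 1) * ‖x - ι a‖ := by ring
    _ < (B + 1) * (δ / (B + 1)) := by gcongr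
    _ = δ := by field_simp

end Main

end Lemmas

end TateTrace

open TateTrace

/-- Tate's normalized trace maps: with `K` a finite extension of `ℚ_p`, `C` the completion
of an algebraic closure `K̄` (via a dense isometric embedding `ι` and the continuous
extension `ρ` of the Galois action), `K_n = K(ε⁽ⁿ⁾)` and `K̂_∞` the closure of
`K_∞ = ⋃ K_n` in `C`, there are maps `pr_{K_n} : K̂_∞ → K_n` which are continuous,
`K_n`-linear, Galois-equivariant sections of the inclusion `K_n ⊆ K̂_∞`, given on each
`K_m` (`m ≥ n`) by `[K_m:K_n]⁻¹·Tr_{K_m/K_n}`, and such that `x = lim_n pr_{K_n}(x)`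
for every `x ∈ K̂_∞`. -/
theorem tate_normalized_traces (p : ℕ) [Fact p.Prime]
    (K : Type*) [Field K] [Algebra ℚ_[p] K] [FiniteDimensional ℚ_[p] K]
    (C : Type*) [NormedField C] [CompleteSpace C] [IsUltrametricDist C]
    (ι : AlgebraicClosure K →+* C) (hdense : DenseRange ι)
    (hext : ∀ a : ℚ_[p],
      ‖ι (algebraMap K (AlgebraicClosure K) (algebraMap ℚ_[p] K a))‖ = ‖a‖)
    (ρ : (AlgebraicClosure K ≃ₐ[K] AlgebraicClosure K) →* (C ≃+* C))
    (hcont : ∀ σ, Continuous (ρ σ))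
    (hcompat : ∀ σ x, ρ σ (ι x) = ι (σ x))
    (ε : ℕ → AlgebraicClosure K)
    (hε0 : ε 0 = 1) (hε1 : ε 1 ≠ 1) (hεp : ∀ n, ε (n + 1) ^ p = ε n) :
    ∃ pr : ℕ → C → C,
      (∀ n, ContinuousOn (pr n) (Khat ι ε)) ∧
      (∀ n, ∀ x ∈ Khat ι ε, pr n x ∈ ι '' (Kn ε n : Set (AlgebraicClosure K))) ∧
      (∀ n, ∀ x ∈ Khat ι ε, ∀ y ∈ Khat ι ε, pr n (x + y) = pr n x + pr n y) ∧
      (∀ n, ∀ a ∈ Kn ε n, ∀ x ∈ Khat ι ε, pr n (ι a * x) = ι a * pr n x) ∧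
      (∀ n, ∀ a ∈ Kn ε n, pr n (ι a) = ι a) ∧
      (∀ n σ, ∀ x ∈ Khat ι ε, pr n (ρ σ x) = ρ σ (pr n x)) ∧
      (∀ n m : ℕ, n ≤ m →
        ∀ hle : Kn ε n ≤ Kn ε m,
        ∀ x : AlgebraicClosure K, ∀ hx : x ∈ IntermediateField.extendScalars hle,
          pr n (ι x) =
            ι (((Module.finrank (Kn ε n)
                  (IntermediateField.extendScalars hle) : AlgebraicClosure K))⁻¹ *
              algebraMap (Kn ε n) (AlgebraicClosure K)
                (Algebra.trace (Kn ε n)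
                  (IntermediateField.extendScalars hle) ⟨x, hx⟩))) ∧
      (∀ x ∈ Khat ι ε, Tendsto (fun n => pr n x) atTop (𝓝 x)) := by
  have hε : ∀ n, IsPrimitiveRoot (ε n) (p ^ n) := isPrimitiveRoot_of_pow_eq hε0 hε1 hεp
  have hι : ∀ a : ℚ_[p], ‖ι (algebraMap ℚ_[p] (AlgebraicClosure K) a)‖ = ‖a‖ := fun a => by
    rw [IsScalarTower.algebraMap_apply ℚ_[p] K (AlgebraicClosure K), hext]
  have : CharZero K := charZero_of_injective_algebraMap (algebraMap ℚ_[p] K).injective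
  have hmono : Monotone (Kn ε) := adjoin_simple_le_adjoin_simple_of_pow hεp
  obtain ⟨pr, hpr, hval, hadd, hlim⟩ := exists_continuous_normalizedTrace (K := K) ι hι hε hεp
  have hGal : ∀ n (σ : AlgebraicClosure K ≃ₐ[K] AlgebraicClosure K), ∀ x ∈ Kn ε n, σ x ∈ Kn ε n :=
    fun n σ x hx =>
      have : NeZero (p ^ n) := ⟨pow_ne_zero n (Fact.out : p.Prime).ne_zero⟩
      map_mem_adjoin_of_isPrimitiveRoot (hε n) σ hx
  have hstable : ∀ u : C → C, Continuous u →
      (∀ m, ∀ x ∈ Kn ε m, ∃ k, ∃ y ∈ Kn ε k, ι y = u (ι x)) →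
      Set.MapsTo u (Khat ι ε) (Khat ι ε) := by
    refine fun u hu h => Set.MapsTo.closure ?_ hu
    rintro _ ⟨x, hx, rfl⟩
    obtain ⟨m, hm⟩ := Set.mem_iUnion.1 hx
    obtain ⟨k, y, hy, hyx⟩ := h m x hm
    exact ⟨y, Set.mem_iUnion.2 ⟨k, hy⟩, hyx⟩
  have hsub : ι '' (⋃ n, (Kn ε n : Set (AlgebraicClosure K))) ⊆ Khat ι ε := subset_closure
  refine ⟨pr, hpr, fun n => ?_, hadd, fun n a ha => ?_, fun n a ha => ?_, fun n σ => ?_,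
    fun n m _ hle x hx => ?_, hlim⟩
  · have hmaps : Set.MapsTo (pr n) (ι '' (⋃ n, (Kn ε n : Set (AlgebraicClosure K))))
        (ι '' (Kn ε n : Set (AlgebraicClosure K))) := by
      rintro _ ⟨x, hx, rfl⟩
      obtain ⟨m, hm⟩ := Set.mem_iUnion.1 hx
      rw [hval n m x hm]
      exact ⟨_, (Algebra.normalizedTrace (Kn ε n) (AlgebraicClosure K) x).2, rfl⟩
    exact (hmaps.closure_of_continuousOn (hpr n)).mono_right
      (isClosed_image_adjoin (K := K) ι hι (ε n)).closure_eq.subset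
  · have hmul : ∀ m, ∀ x ∈ Kn ε m, a * x ∈ Kn ε (max n m) := fun m x hx =>
      mul_mem (hmono (le_max_left n m) ha) (hmono (le_max_right n m) hx)
    refine Set.EqOn.of_subset_closure ?_ ((hpr n).comp (continuous_const_mul _).continuousOn
      (hstable _ (continuous_const_mul (ι a)) fun m x hx =>
        ⟨_, _, hmul m x hx, map_mul ι a x⟩)) ((hpr n).const_mul _) hsub le_rfl
    rintro _ ⟨x, hx, rfl⟩
    obtain ⟨m, hm⟩ := Set.mem_iUnion.1 hx
    change pr n (ι a * ι x) = ι a * pr n (ι x)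
    rw [← map_mul, hval n _ _ (hmul m x hm), hval n m x hm, ← map_mul]
    exact congrArg (fun z : Kn ε n => ι z)
      ((Algebra.normalizedTrace (Kn ε n) (AlgebraicClosure K)).map_smul ⟨a, ha⟩ x)
  · rw [hval n n a ha]
    exact congrArg (fun z : Kn ε n => ι z) (Algebra.normalizedTrace_algebraMap_apply_eq_self
      (Kn ε n) (AlgebraicClosure K) ⟨a, ha⟩)
  · refine Set.EqOn.of_subset_closure ?_ ((hpr n).comp (hcont σ).continuousOn
      (hstable _ (hcont σ) fun m x hx => ⟨m, σ x, hGal m σ x hx, (hcompat σ x).symm⟩))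
      ((hcont σ).comp_continuousOn (hpr n)) hsub le_rfl
    rintro _ ⟨x, hx, rfl⟩
    obtain ⟨m, hm⟩ := Set.mem_iUnion.1 hx
    change pr n (ρ σ (ι x)) = ρ σ (pr n (ι x))
    rw [hcompat, hval n m x hm, hval n m _ (hGal m σ x hm), hcompat]
    exact congrArg ι (coe_normalizedTrace_algEquiv (hGal n) σ x)
  · have : FiniteDimensional K (Kn ε m) :=
      IntermediateField.adjoin.finiteDimensional (Algebra.IsIntegral.isIntegral (ε m))
    rw [hval n m x hx]
    exact congrArg ι (normalizedTrace_eq_of_mem_extendScalars hle hx)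
end
end
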